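/- arXiv:math/0601141 — 2 statements merged into one kernel-verified Lean document; each statement's English description precedes it below -/
import Mathlib

section
/- Let X be a geometrically integral curve over a perfect field k with a k-rational point, and let L ⊇ k be an algebraic field extension. Then γ_L(X) ≥ √(γ_k(X)). -/
open IntermediateField

/-- The gonality of the function field `F` of a curve over `k`: the smallest degree
`[F : k(f)]` of a nonconstant rational function `f ∈ F`, i.e. the smallest degree of a
dominant rational map from the curve to `ℙ¹_k`. -/
noncomputable def gonality (k F : Type*) [Field k] [Field F] [Algebra k F] : ℕ :=
  sInf {d : ℕ | ∃ f : F, Transcendental k f ∧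
    Module.finrank (IntermediateField.adjoin k {f}) F = d}

/-- `F` is the function field of a curve over `k`: a finitely generated field extension of
transcendence degree 1, i.e. a finite extension of some `k(x)` with `x` transcendental. -/
def IsFunctionField (k F : Type*) [Field k] [Field F] [Algebra k F] : Prop :=
  ∃ x : F, Transcendental k x ∧
    FiniteDimensional (IntermediateField.adjoin k {x}) F

/-- A place of the function field `F/k`: a valuation subring of `F` containing `k`
and different from `F` itself.  These correspond to the closed points of the smooth
projective model of the curve. -/
structure FFPlace (k F : Type*) [Field k] [Field F] [Algebra k F] where
  asSubring : ValuationSubring F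
  algebraMap_mem : ∀ a : k, algebraMap k F a ∈ asSubring
  ne_top : asSubring ≠ ⊤

variable (k F : Type*) [Field k] [Field F] [Algebra k F]

/-- The degree of a place: the `k`-dimension of its residue field. -/
noncomputable def FFPlace.degree (P : FFPlace k F) : ℕ :=
  letI : Algebra k (IsLocalRing.ResidueField P.asSubring) :=
    ((IsLocalRing.residue (P.asSubring : Type _)).comp
      ((algebraMap k F).codRestrict P.asSubring.toSubring P.algebraMap_mem)).toAlgebra
  Module.finrank k (IsLocalRing.ResidueField P.asSubring)

/-- The space of adeles (repartitions) of `F/k`: families `(α_P)_P` indexed by the places of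
`F/k` with `α_P` integral at all but finitely many places, as a `k`-submodule of `Π_P F`. -/
def adeleSubmodule : Submodule k (FFPlace k F → F) where
  carrier := {α | {P : FFPlace k F | α P ∉ P.asSubring}.Finite}
  zero_mem' := by
    show {P : FFPlace k F | (0 : F) ∉ P.asSubring}.Finite
    convert Set.finite_empty using 2
    ext P
    simp [zero_mem]
  add_mem' := by
    intro a b ha hb
    refine Set.Finite.subset (ha.union hb) ?_
    intro P hP
    rw [Set.mem_union]
    by_contra h
    push_neg at h
    simp only [Set.mem_setOf_eq, not_not] at h
    exact hP (add_mem h.1 h.2)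
  smul_mem' := by
    intro c α hα
    refine Set.Finite.subset hα ?_
    intro P hP
    by_contra h
    simp only [Set.mem_setOf_eq, not_not] at h
    refine hP ?_
    show c • α P ∈ P.asSubring
    rw [Algebra.smul_def]
    exact mul_mem (P.algebraMap_mem c) h

/-- The adeles that are integral at every place. -/
def integralAdeles : Submodule k (FFPlace k F → F) where
  carrier := {α | ∀ P : FFPlace k F, α P ∈ P.asSubring}
  zero_mem' := fun P => zero_mem _
  add_mem' := fun ha hb P => add_mem (ha P) (hb P)
  smul_mem' := by
    intro c α hα P
    show c • α P ∈ P.asSubring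
    rw [Algebra.smul_def]
    exact mul_mem (P.algebraMap_mem c) (hα P)

/-- The principal adeles: the diagonal image of `F`. -/
def principalAdeles : Submodule k (FFPlace k F → F) :=
  LinearMap.range (LinearMap.pi fun _ : FFPlace k F => (LinearMap.id : F →ₗ[k] F))

/-- The genus of the function field `F/k`, defined à la Chevalley/Weil as the `k`-dimension of
`A / (A(0) + F)`, where `A` is the space of adeles, `A(0)` the everywhere-integral ones and `F`
the principal ones.  For the function field of a geometrically integral smooth projective curve
this is the usual genus. -/
noncomputable def genus : ℕ :=
  Module.finrank k
    (↥(adeleSubmodule k F) ⧸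
      ((integralAdeles k F ⊔ principalAdeles k F).comap (adeleSubmodule k F).subtype))

open Polynomial

section

variable {L K : Type*} [Field L] [Field K] [Algebra L K]

theorem linearIndependent_adjoin_iff {ι : Type*} {t : K} (ht : Transcendental L t) (b : ι → K) :
    LinearIndependent L⟮t⟯ b ↔ LinearIndependent L (fun p : ℕ × ι => t ^ p.1 * b p.2) := by
  classical
  have hpow : LinearIndependent L (fun n : ℕ => t ^ n) := by
    have := (Polynomial.basisMonomials L).linearIndependent.map' (aeval t : L[X] →ₐ[L] K).toLinearMap
      (LinearMap.ker_eq_bot.2 (transcendental_iff_injective.1 ht))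
    have e : (fun n : ℕ => t ^ n) =
        ⇑(aeval t : L[X] →ₐ[L] K).toLinearMap ∘ ⇑(Polynomial.basisMonomials L) := by
      ext n
      simp [aeval_monomial]
    rw [e]
    exact this
  constructor
  · intro h
    let g : L⟮t⟯ := AdjoinSimple.gen L t
    have hg : LinearIndependent L (fun n : ℕ => g ^ n) := by
      refine LinearIndependent.of_comp (L⟮t⟯.val.toLinearMap) ?_
      have e : ⇑(L⟮t⟯.val.toLinearMap) ∘ (fun n : ℕ => g ^ n) = fun n : ℕ => t ^ n := by
        ext n
        simp [g]
      rw [e]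
      exact hpow
    have := linearIndependent_smul hg h
    have e : (fun p : ℕ × ι => t ^ p.1 * b p.2) = fun p => g ^ p.1 • b p.2 := by
      ext p
      simp [g, IntermediateField.smul_def]
    rw [e]
    exact this
  · intro h
    rw [linearIndependent_iff']
    intro s g hg
    choose r q hrq using fun i => (mem_adjoin_simple_iff L ((g i : K))).1 (g i).2
    by_contra! hne
    obtain ⟨i₀, hi₀, hgi₀⟩ := hne
    -- drop the indices with zero coefficient
    let s' := s.filter (fun i => g i ≠ 0)
    have hmem : i₀ ∈ s' := by simp [s', hi₀, hgi₀]
    have hq : ∀ i ∈ s', aeval t (q i) ≠ 0 := by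
      intro i hi h0
      have := hrq i
      rw [h0, div_zero] at this
      simp only [s', Finset.mem_filter] at hi
      exact hi.2 (by exact_mod_cast this)
    let P : ι → L[X] := fun i => r i * ∏ j ∈ s'.erase i, q j
    have hP : ∑ i ∈ s', aeval t (P i) * b i = 0 := by
      have h1 : ∑ i ∈ s', (g i : K) * b i = 0 := by
        rw [← hg]
        simp only [s']
        rw [Finset.sum_filter]
        refine Finset.sum_congr rfl fun i _ => ?_
        by_cases h : g i = 0
        · simp [h]
        · simp [h, IntermediateField.smul_def]
      have h2 : ∀ i ∈ s', aeval t (P i) = (∏ j ∈ s', aeval t (q j)) * (g i : K) := by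
        intro i hi
        rw [hrq i, ← Finset.mul_prod_erase _ _ hi]
        simp only [P, map_mul, map_prod]
        field_simp [hq i hi]
      rw [Finset.sum_congr rfl fun i hi => by rw [h2 i hi, mul_assoc], ← Finset.mul_sum, h1, mul_zero]
    have hP0 : P i₀ ≠ 0 := by
      refine mul_ne_zero ?_ (Finset.prod_ne_zero_iff.2 fun j hj => ?_)
      · intro h0
        have := hrq i₀
        rw [h0, map_zero, zero_div] at this
        exact hgi₀ (by exact_mod_cast this)
      · intro h0
        exact hq j (Finset.mem_of_mem_erase hj) (by rw [h0, map_zero])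
    rw [linearIndependent_iff'] at h
    obtain ⟨n, hn⟩ : ∃ n, (P i₀).coeff n ≠ 0 := by
      by_contra! h0
      exact hP0 (Polynomial.ext (by simpa using h0))
    let N := s'.sup (fun i => (P i).natDegree) + 1
    have key := h (Finset.range N ×ˢ s') (fun p => (P p.2).coeff p.1) ?_ (n, i₀) ?_
    · exact hn key
    · rw [Finset.sum_product_right, ← hP]
      refine Finset.sum_congr rfl fun i hi => ?_
      rw [aeval_eq_sum_range' (n := N) (Nat.lt_succ_of_le
        (Finset.le_sup (f := fun i => (P i).natDegree) hi)), Finset.sum_mul]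
      simp
    · simp only [Finset.mem_product, hmem, and_true, Finset.mem_range]
      exact (Polynomial.le_natDegree_of_ne_zero hn).trans_lt (Nat.lt_succ_of_le
        (Finset.le_sup (f := fun i => (P i).natDegree) hmem))

/-- More than `[K : L(t)]` elements satisfy a relation with coefficients in `L[t]`, not all
divisible by `t`. -/
theorem exists_polynomial_relation {ι : Type*} [Fintype ι] {t : K} (ht : Transcendental L t)
    [FiniteDimensional L⟮t⟯ K] (hι : Module.finrank L⟮t⟯ K < Fintype.card ι) (b : ι → K) :
    ∃ p : ι → L[X], ∑ i, aeval t (p i) * b i = 0 ∧ ∃ i, (p i).coeff 0 ≠ 0 := by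
  classical
  have hdep : ¬ LinearIndependent L⟮t⟯ b := fun h => by
    have := h.fintype_card_le_finrank
    omega
  rw [linearIndependent_adjoin_iff ht, linearIndependent_iff'] at hdep
  push Not at hdep
  obtain ⟨s, c, hc, ⟨n₀, i₀⟩, hs, hne⟩ := hdep
  let p : ι → L[X] := fun i => ∑ n ∈ (s.filter (fun x => x.2 = i)).image Prod.fst, monomial n (c (n, i))
  have hcoeff : ∀ i n, (p i).coeff n = if (n, i) ∈ s then c (n, i) else 0 := by
    intro i n
    simp only [p, finsetSum_coeff, coeff_monomial]
    rw [Finset.sum_ite_eq']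
    simp
  have hrel : ∑ i, aeval t (p i) * b i = 0 := by
    rw [← hc, ← Finset.sum_fiberwise s (fun x => x.2) (fun x => c x • (t ^ x.1 * b x.2))]
    refine Finset.sum_congr rfl fun i _ => ?_
    simp only [p, map_sum, aeval_monomial, Finset.sum_mul]
    rw [Finset.sum_image]
    · refine Finset.sum_congr rfl fun x hx => ?_
      obtain ⟨-, rfl⟩ := Finset.mem_filter.1 hx
      simp [Algebra.smul_def, mul_assoc]
    · intro x hx y hy hxy
      simp at hx hy
      exact Prod.ext hxy (hx.2.trans hy.2.symm)
  have hp0 : p i₀ ≠ 0 := fun h => by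
    have := hcoeff i₀ n₀
    rw [h, if_pos hs] at this
    exact hne this.symm
  let A : Finset ι := Finset.univ.filter (fun i => p i ≠ 0)
  obtain ⟨j, hj, hmin⟩ := A.exists_min_image (fun i => (p i).natTrailingDegree) ⟨i₀, by simp [A, hp0]⟩
  set m := (p j).natTrailingDegree with hm
  have hdvd : ∀ i, X ^ m ∣ p i := by
    intro i
    by_cases h : p i = 0
    · simp [h]
    rw [X_pow_dvd_iff]
    intro n hn
    exact coeff_eq_zero_of_lt_natTrailingDegree (hn.trans_le (hmin i (by simp [A, h])))
  choose q hq using hdvd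
  have ht0 : t ≠ 0 := fun h => ht (h ▸ isAlgebraic_zero)
  refine ⟨q, ?_, j, ?_⟩
  · have : t ^ m * ∑ i, aeval t (q i) * b i = 0 := by
      rw [← hrel, Finset.mul_sum]
      refine Finset.sum_congr rfl fun i _ => ?_
      conv_rhs => rw [hq i]
      simp [mul_assoc]
    exact (mul_eq_zero.1 this).resolve_left (pow_ne_zero _ ht0)
  · have h1 : (p j).coeff m ≠ 0 := by
      have : p j ≠ 0 := (Finset.mem_filter.1 hj).2
      simpa [hm, Polynomial.trailingCoeff] using this
    rw [hq j] at h1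
    simpa [coeff_X_pow_mul'] using h1

/-- A submodule `B` is contained in `A` up to adding `n` generators. -/
def CodimLE (A B : Submodule L K) (n : ℕ) : Prop :=
  ∃ s : Finset K, s.card ≤ n ∧ B ≤ A ⊔ Submodule.span L (s : Set K)

theorem CodimLE.trans {A B C : Submodule L K} {m n : ℕ} (h₁ : CodimLE A B m)
    (h₂ : CodimLE B C n) : CodimLE A C (m + n) := by
  classical
  obtain ⟨s, hs, hBs⟩ := h₁
  obtain ⟨u, hu, hCu⟩ := h₂
  refine ⟨s ∪ u, (Finset.card_union_le _ _).trans (add_le_add hs hu), ?_⟩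
  rw [Finset.coe_union, Submodule.span_union, ← sup_assoc]
  exact hCu.trans (sup_le_sup_right hBs _)

theorem CodimLE.of_le {A B : Submodule L K} (h : B ≤ A) (n : ℕ) : CodimLE A B n :=
  ⟨∅, by simp, h.trans le_sup_left⟩

/-- Iterated form of transitivity. -/
theorem CodimLE.iterate {A : ℕ → Submodule L K} {n : ℕ} (h : ∀ j, CodimLE (A j) (A (j + 1)) n)
    (i j : ℕ) : CodimLE (A i) (A (i + j)) (j * n) := by
  induction j with
  | zero => exact .of_le le_rfl _
  | succ j ih =>
    rw [Nat.succ_mul]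
    exact ih.trans (h (i + j))

theorem codimLE_of_dependent {A B : Submodule L K} {n : ℕ}
    (h : ∀ b : Fin (n + 1) → K, (∀ i, b i ∈ B) → ∃ c : Fin (n + 1) → L, c ≠ 0 ∧
      ∑ i, c i • b i ∈ A) : CodimLE A B n := by
  classical
  by_contra hcon
  have key : ∀ m ≤ n + 1, ∃ b : Fin m → K, (∀ i, b i ∈ B) ∧
      ∀ c : Fin m → L, ∑ i, c i • b i ∈ A → c = 0 := by
    intro m
    induction m with
    | zero => exact fun _ => ⟨Fin.elim0, fun i => i.elim0, fun c _ => Subsingleton.elim _ _⟩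
    | succ m ih =>
      intro hm
      obtain ⟨b, hb, hc⟩ := ih (by omega)
      obtain ⟨x, hxB, hx⟩ : ∃ x ∈ B, x ∉ A ⊔ Submodule.span L (Set.range b) := by
        by_contra! hall
        refine hcon ⟨Finset.univ.image b, Finset.card_image_le.trans (by simp; omega), ?_⟩
        rw [Finset.coe_image, Finset.coe_univ, Set.image_univ]
        exact fun x hx => hall x hx
      refine ⟨Fin.cons x b, fun i => Fin.cases hxB hb i, fun c hcA => ?_⟩
      rw [Fin.sum_univ_succ] at hcA
      simp only [Fin.cons_zero, Fin.cons_succ] at hcA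
      have hc0 : c 0 = 0 := by
        by_contra hne
        refine hx ?_
        have h1 : x = (c 0)⁻¹ • (c 0 • x + ∑ i : Fin m, c i.succ • b i)
            + -((c 0)⁻¹ • ∑ i : Fin m, c i.succ • b i) := by
          rw [smul_add, smul_smul, inv_mul_cancel₀ hne, one_smul]
          abel
        rw [h1]
        refine Submodule.add_mem_sup (A.smul_mem _ hcA) (neg_mem (Submodule.smul_mem _ _ ?_))
        exact Submodule.sum_mem _ fun i _ =>
          Submodule.smul_mem _ _ (Submodule.subset_span ⟨i, rfl⟩)
      rw [hc0, zero_smul, zero_add] at hcA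
      have := hc (fun i => c i.succ) hcA
      funext i
      refine Fin.cases hc0 (fun i => congrFun this i) i
  obtain ⟨b, hb, hc⟩ := key (n + 1) le_rfl
  obtain ⟨c, hc0, hcA⟩ := h b hb
  exact hc0 (hc c hcA)

theorem CodimLE.card_le {B : Submodule L K} {n : ℕ} (h : CodimLE ⊥ B n) {ι : Type*} [Fintype ι]
    {b : ι → K} (hb : LinearIndependent L b) (hB : ∀ i, b i ∈ B) : Fintype.card ι ≤ n := by
  obtain ⟨s, hs, hBs⟩ := h
  rw [bot_sup_eq] at hBs
  have h1 : Set.finrank L (Set.range b) ≤ (Set.finrank L (s : Set K)) :=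
    Submodule.finrank_mono (Submodule.span_le.2 (by
      rintro _ ⟨i, rfl⟩
      exact hBs (hB i)))
  have h2 := finrank_span_eq_card hb
  have h3 := finrank_span_finset_le_card (R := L) s
  have h4 : Module.finrank L (Submodule.span L (Set.range b)) ≤ s.card := h1.trans h3
  omega

variable (L) in
/-- A valuation subring containing the constants. -/
def ContainsConstants (Q : ValuationSubring K) : Prop := ∀ c : L, algebraMap L K c ∈ Q

section valuation

variable {Q : ValuationSubring K} (hQ : ContainsConstants L Q)
include hQ

theorem ContainsConstants.valuation_algebraMap_le (c : L) :
    Q.valuation (algebraMap L K c) ≤ 1 := (Q.valuation_le_one_iff _).2 (hQ c)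

theorem ContainsConstants.valuation_algebraMap {c : L} (hc : c ≠ 0) :
    Q.valuation (algebraMap L K c) = 1 := by
  refine le_antisymm (hQ.valuation_algebraMap_le c) ?_
  have h1 := hQ.valuation_algebraMap_le c⁻¹
  rw [map_inv₀, map_inv₀] at h1
  have : Q.valuation (algebraMap L K c) ≠ 0 := by simpa using hc
  exact (inv_le_one₀ (zero_lt_iff.2 this)).1 h1

theorem ContainsConstants.valuation_smul_le (c : L) (x : K) :
    Q.valuation (c • x) ≤ Q.valuation x := by
  rw [Algebra.smul_def, map_mul]
  exact mul_le_of_le_one_left' (hQ.valuation_algebraMap_le c)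

theorem ContainsConstants.valuation_smul {c : L} (hc : c ≠ 0) (x : K) :
    Q.valuation (c • x) = Q.valuation x := by
  rw [Algebra.smul_def, map_mul, hQ.valuation_algebraMap hc, one_mul]

theorem ContainsConstants.valuation_aeval_le {t : K} (ht : Q.valuation t ≤ 1) (p : L[X]) :
    Q.valuation (aeval t p) ≤ 1 := by
  rw [aeval_eq_sum_range]
  refine Valuation.map_sum_le _ fun i _ => (hQ.valuation_smul_le _ _).trans ?_
  rw [map_pow]
  exact pow_le_one' ht i

omit hQ in
theorem aeval_eq_mul_divX_add (t : K) (p : L[X]) :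
    aeval t p = t * aeval t p.divX + algebraMap L K (p.coeff 0) := by
  conv_lhs => rw [← Polynomial.X_mul_divX_add p, map_add, map_mul, aeval_X, aeval_C]

theorem ContainsConstants.valuation_aeval_le_of_coeff_eq_zero {t : K} (ht : Q.valuation t ≤ 1)
    {p : L[X]} (hp : p.coeff 0 = 0) : Q.valuation (aeval t p) ≤ Q.valuation t := by
  rw [aeval_eq_mul_divX_add, hp, map_zero, add_zero, map_mul]
  exact mul_le_of_le_one_right' (hQ.valuation_aeval_le ht _)

theorem ContainsConstants.valuation_aeval_eq_one {t : K} (ht : Q.valuation t < 1)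
    {p : L[X]} (hp : p.coeff 0 ≠ 0) : Q.valuation (aeval t p) = 1 := by
  rw [aeval_eq_mul_divX_add, Valuation.map_add_eq_of_lt_right, hQ.valuation_algebraMap hp]
  rw [hQ.valuation_algebraMap hp, map_mul]
  exact mul_lt_one_of_lt_of_le ht (hQ.valuation_aeval_le ht.le _)

/-- There are at most `[K : L(t)]` values in the interval `(v t, 1]`. -/
theorem ContainsConstants.card_le_finrank {t : K} (ht : Transcendental L t)
    [FiniteDimensional L⟮t⟯ K] (htQ : Q.valuation t < 1) {ι : Type*} [Fintype ι] (x : ι → K)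
    (hx : Function.Injective fun i => Q.valuation (x i))
    (hx₁ : ∀ i, Q.valuation t < Q.valuation (x i)) (hx₂ : ∀ i, Q.valuation (x i) ≤ 1) :
    Fintype.card ι ≤ Module.finrank L⟮t⟯ K := by
  classical
  by_contra! hlt
  obtain ⟨p, hp, i₁, hi₁⟩ := exists_polynomial_relation ht hlt x
  obtain ⟨i, hi, hmax⟩ := (Finset.univ.filter fun i => (p i).coeff 0 ≠ 0).exists_max_image
    (fun i => Q.valuation (x i)) ⟨i₁, by simpa using hi₁⟩
  rw [Finset.mem_filter] at hi
  have hvi : Q.valuation (aeval t (p i) * x i) = Q.valuation (x i) := by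
    rw [map_mul, hQ.valuation_aeval_eq_one htQ hi.2, one_mul]
  have hlt' : Q.valuation (∑ j ∈ Finset.univ.erase i, aeval t (p j) * x j) < Q.valuation (x i) := by
    refine Valuation.map_sum_lt _ ((zero_le.trans_lt (hx₁ i)).ne') fun j hj => ?_
    rw [map_mul]
    by_cases h0 : (p j).coeff 0 = 0
    · exact (mul_le_of_le_one_right' (hx₂ j)).trans_lt
        ((hQ.valuation_aeval_le_of_coeff_eq_zero htQ.le h0).trans_lt (hx₁ i))
    · rw [hQ.valuation_aeval_eq_one htQ h0, one_mul]
      refine lt_of_le_of_ne (hmax j (by simpa using h0)) fun h => ?_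
      exact (Finset.ne_of_mem_erase hj) (hx h)
  rw [← Finset.add_sum_erase _ _ (Finset.mem_univ i)] at hp
  rw [← hvi] at hlt'
  have := Valuation.map_add_eq_of_lt_left Q.valuation hlt'
  rw [hp, map_zero, hvi] at this
  exact (zero_le.trans_lt (hx₁ i)).ne this

theorem ContainsConstants.valuation_pow_finrank_le {t : K} (ht : Transcendental L t)
    [FiniteDimensional L⟮t⟯ K] (htQ : Q.valuation t < 1) {w : K} (hw : Q.valuation w < 1) :
    Q.valuation w ^ Module.finrank L⟮t⟯ K ≤ Q.valuation t := by
  by_contra! hlt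
  have hw0 : Q.valuation w ≠ 0 := fun h => by
    have : Module.finrank L⟮t⟯ K ≠ 0 := Module.finrank_pos.ne'
    rw [h, zero_pow this] at hlt
    exact not_lt_zero hlt
  have := hQ.card_le_finrank ht htQ (fun i : Fin (Module.finrank L⟮t⟯ K + 1) => w ^ (i : ℕ)) ?_ ?_ ?_
  · simp at this
  · intro i j hij
    simp only [map_pow] at hij
    exact Fin.ext ((pow_right_strictAnti₀ (zero_lt_iff.2 hw0) hw).injective hij)
  · intro i
    rw [map_pow]
    exact hlt.trans_le (pow_le_pow_right_of_le_one' hw.le (Nat.lt_succ_iff.1 i.2))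
  · intro i
    rw [map_pow]
    exact pow_le_one' hw.le _

/-- Valuation rings of a function field are discrete. -/
theorem ContainsConstants.exists_uniformizer {t : K} (ht : Transcendental L t)
    [FiniteDimensional L⟮t⟯ K] (htQ : Q.valuation t < 1) :
    ∃ π : K, π ≠ 0 ∧ Q.valuation π < 1 ∧ ∀ x, Q.valuation x < 1 → Q.valuation x ≤ Q.valuation π := by
  classical
  have ht0 : t ≠ 0 := fun h => ht (h ▸ isAlgebraic_zero)
  let T : Set Q.ValueGroup := {γ | Q.valuation t < γ ∧ γ < 1}
  have hT : T.Finite := by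
    by_contra hinf
    obtain ⟨s, hsT, hs⟩ := Set.Infinite.exists_subset_card_eq hinf (Module.finrank L⟮t⟯ K + 1)
    choose x hx using fun γ : s => Q.valuation_surjective (γ : Q.ValueGroup)
    have := hQ.card_le_finrank ht htQ x (fun i j hij => Subtype.ext (by simpa [hx] using hij))
      (fun i => by rw [hx]; exact (hsT i.2).1) (fun i => by rw [hx]; exact (hsT i.2).2.le)
    simp [hs] at this
  by_cases hne : T.Nonempty
  · obtain ⟨γ, hγ, hmax⟩ := Set.exists_max_image T id hT hne
    obtain ⟨π, rfl⟩ := Q.valuation_surjective γ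
    refine ⟨π, fun h => ?_, hγ.2, fun x hx => ?_⟩
    · rw [h, map_zero] at hγ
      exact not_lt_zero hγ.1
    · by_cases hxt : Q.valuation t < Q.valuation x
      · exact hmax _ ⟨hxt, hx⟩
      · exact (not_lt.1 hxt).trans hγ.1.le
  · refine ⟨t, ht0, htQ, fun x hx => ?_⟩
    by_contra! h
    exact hne ⟨_, h, hx⟩

end valuation

theorem ContainsConstants.mem_of_isIntegral {Q : ValuationSubring K} (hQ : ContainsConstants L Q)
    {g z : K} (hg : g ∈ Q) (hz : IsIntegral (Algebra.adjoin L {g}) z) : z ∈ Q := by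
  have hle : ∀ x : Algebra.adjoin L {g}, (x : K) ∈ Q := by
    intro x
    obtain ⟨p, hp⟩ := (Algebra.adjoin_singleton_eq_range_aeval L g).le x.2
    change aeval g p = _ at hp
    rw [← hp]
    exact (Q.valuation_le_one_iff _).1
      (hQ.valuation_aeval_le ((Q.valuation_le_one_iff _).2 hg) p)
  have h1 : IsIntegral Q z := by
    refine IsIntegral.map_of_comp_eq
      (((Algebra.adjoin L {g}).val : Algebra.adjoin L {g} →+* K).codRestrict Q.toSubring hle :
        Algebra.adjoin L {g} →+* Q) (RingHom.id K) ?_ hz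
    ext x
    rfl
  obtain ⟨y, rfl⟩ := (IsIntegrallyClosed.isIntegral_iff (R := Q) (K := K)).1 h1
  exact y.2

open scoped IntermediateField.algebraAdjoinAdjoin in
theorem exists_aeval_mul_isIntegral (t : K) [FiniteDimensional L⟮t⟯ K] (z : K) :
    ∃ p : L[X], aeval t p ≠ 0 ∧ IsIntegral (Algebra.adjoin L {t}) (aeval t p * z) := by
  have h1 : IsAlgebraic L⟮t⟯ z := Algebra.IsAlgebraic.isAlgebraic z
  have h2 : IsAlgebraic (Algebra.adjoin L {t}) z :=
    (IsFractionRing.isAlgebraic_iff (Algebra.adjoin L {t}) L⟮t⟯ K).2 h1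
  obtain ⟨y, hy0, hy⟩ := h2.exists_integral_multiple
  obtain ⟨p, hp⟩ := (Algebra.adjoin_singleton_eq_range_aeval L t).le y.2
  refine ⟨p, ?_, ?_⟩
  · change aeval t p = _ at hp
    rw [hp]
    simpa using hy0
  · change aeval t p = _ at hp
    rw [hp]
    exact hy

/-- Every function becomes integral at all zeros of `t` after multiplication by a power of `t`. -/
theorem exists_pow_mul_valuation_le (t : K) [FiniteDimensional L⟮t⟯ K] (z : K) :
    ∃ m : ℕ, ∀ Q : ValuationSubring K,
    ContainsConstants L Q → Q.valuation t < 1 → Q.valuation (t ^ m * z) ≤ 1 := by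
  obtain ⟨p, hp0, hp⟩ := exists_aeval_mul_isIntegral (L := L) t z
  have hp0' : p ≠ 0 := fun h => hp0 (by rw [h, map_zero])
  obtain ⟨q, hpq, hq⟩ := Polynomial.exists_eq_pow_rootMultiplicity_mul_and_not_dvd p hp0' 0
  rw [C_0, sub_zero] at hpq hq
  rw [X_dvd_iff] at hq
  refine ⟨p.rootMultiplicity 0, fun Q hQ htQ => ?_⟩
  have h1 := (Q.valuation_le_one_iff _).2
    (hQ.mem_of_isIntegral ((Q.valuation_le_one_iff _).1 htQ.le) hp)
  rw [hpq] at h1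
  simpa [hQ.valuation_aeval_eq_one htQ hq] using h1

theorem ValuationSubring.valuation_mul_lt_one {Q : ValuationSubring K} {x y : K}
    (hx : Q.valuation x ≤ 1) (hy : Q.valuation y < 1) : Q.valuation (x * y) < 1 := by
  rw [mul_comm, map_mul]
  exact mul_lt_one_of_lt_of_le hy hx

theorem exists_separating {t : K} (ht : Transcendental L t) [FiniteDimensional L⟮t⟯ K]
    {P Q : ValuationSubring K} (hP : ContainsConstants L P) (hQ : ContainsConstants L Q)
    (htP : P.valuation t < 1) (htQ : Q.valuation t < 1) (hne : Q ≠ P) :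
    ∃ x : K, (∀ Q' : ValuationSubring K, ContainsConstants L Q' → Q'.valuation t < 1 →
      Q'.valuation x ≤ 1) ∧ Q.valuation x < 1 ∧ P.valuation x = 1 := by
  by_contra! hcon
  have hlt : ∀ x : K, (∀ Q' : ValuationSubring K, ContainsConstants L Q' → Q'.valuation t < 1 →
      Q'.valuation x ≤ 1) → Q.valuation x < 1 → P.valuation x < 1 :=
    fun x hx hxQ => lt_of_le_of_ne (hx P hP htP) (hcon x hx hxQ)
  have hPQ : P ≤ Q := by
    intro x hxP
    by_contra hxQ
    have hxP' : P.valuation x ≤ 1 := (P.valuation_le_one_iff _).2 hxP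
    have hxQ' : 1 < Q.valuation x := not_le.1 fun h => hxQ ((Q.valuation_le_one_iff _).1 h)
    set d := Module.finrank L⟮t⟯ K
    obtain ⟨p, hp, i₀, hi₀⟩ := exists_polynomial_relation ht (ι := Fin (d + 1))
      (by simp [d]) (fun i => x ^ (i : ℕ))
    let q : ℕ → L[X] := fun i => if h : i < d + 1 then p ⟨i, h⟩ else 0
    let B : ℕ → K := fun j => ∑ i ∈ Finset.range (d + 1 - j), aeval t (q (i + j)) * x ^ i
    have hB0 : B 0 = 0 := by
      rw [← hp]
      simp only [B]
      rw [Nat.sub_zero, ← Fin.sum_univ_eq_sum_range (fun i => aeval t (q (i + 0)) * x ^ i)]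
      refine Finset.sum_congr rfl fun i _ => ?_
      simp only [q, add_zero, dif_pos i.2]
    have hB : ∀ j, B j = aeval t (q j) + x * B (j + 1) := by
      intro j
      simp only [B]
      by_cases h : j < d + 1
      · obtain ⟨e, he⟩ : ∃ e, d + 1 - j = e + 1 := ⟨d - j, by omega⟩
        have he' : d + 1 - (j + 1) = e := by omega
        rw [he, he', Finset.sum_range_succ', Finset.mul_sum, add_comm]
        congr 1
        · simp
        · refine Finset.sum_congr rfl fun i _ => ?_
          rw [show i + 1 + j = i + (j + 1) by ring, pow_succ]
          ring
      · have h1 : d + 1 - j = 0 := by omega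
        have h2 : d + 1 - (j + 1) = 0 := by omega
        rw [h1, h2]
        simp only [q, dif_neg h, map_zero, Finset.range_zero, Finset.sum_empty, mul_zero, add_zero]
    have hBR : ∀ Q' : ValuationSubring K, ContainsConstants L Q' → Q'.valuation t < 1 →
        ∀ j, Q'.valuation (B j) ≤ 1 := by
      intro Q' hQ' htQ' j
      by_cases hx : Q'.valuation x ≤ 1
      · refine Valuation.map_sum_le _ fun i _ => ?_
        rw [map_mul, map_pow]
        exact mul_le_one' (hQ'.valuation_aeval_le htQ'.le _) (pow_le_one' hx _)
      · induction j with
        | zero => rw [hB0, map_zero]; exact zero_le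
        | succ j ih =>
          have h1 : x * B (j + 1) = B j - aeval t (q j) := by rw [hB j]; ring
          have h2 : Q'.valuation (x * B (j + 1)) ≤ 1 := by
            rw [h1]
            exact Valuation.map_sub_le _ ih (hQ'.valuation_aeval_le htQ'.le _)
          rw [map_mul] at h2
          by_contra! h3
          exact absurd h2 (not_le.2 (one_lt_mul'' (not_le.1 hx) h3))
    have hxB : ∀ j, x * B (j + 1) = B j - aeval t (q j) := fun j => by rw [hB j]; ring
    have hBP : ∀ j, P.valuation (B j) < 1 := by
      intro j
      cases j with
      | zero => rw [hB0, map_zero]; exact zero_lt_one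
      | succ j =>
        refine hlt _ (fun Q' h1 h2 => hBR Q' h1 h2 _) ?_
        have h2 : Q.valuation (x * B (j + 1)) ≤ 1 := by
          rw [hxB]
          exact Valuation.map_sub_le _ (hBR Q hQ htQ j) (hQ.valuation_aeval_le htQ.le _)
        rw [map_mul] at h2
        by_contra! h3
        exact absurd h2 (not_le.2 (one_lt_mul_of_lt_of_le' hxQ' h3))
    have hq : aeval t (q i₀) = B i₀ - x * B (i₀ + 1) := by rw [hB i₀]; ring
    have h1 : P.valuation (aeval t (q i₀)) < 1 := by
      rw [hq]
      refine Valuation.map_sub_lt _ (hBP _) ?_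
      exact P.valuation_mul_lt_one hxP' (hBP _)
    have h2 : q i₀ = p i₀ := by simp only [q, dif_pos i₀.2]
    rw [h2, hP.valuation_aeval_eq_one htP hi₀] at h1
    exact lt_irrefl _ h1
  refine hne (le_antisymm (fun x hxQ => ?_) hPQ)
  by_contra hxP
  have hx1 : 1 < P.valuation x := not_le.1 fun h => hxP ((P.valuation_le_one_iff _).1 h)
  have hx0 : x ≠ 0 := fun h => by simp [h] at hx1
  have ht0 : t ≠ 0 := fun h => ht (h ▸ isAlgebraic_zero)
  have hxi : P.valuation x⁻¹ < 1 := by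
    rw [map_inv₀]
    exact inv_lt_one_of_one_lt₀ hx1
  have h1 := hP.valuation_pow_finrank_le ht htP hxi
  have h2 : P.valuation (x⁻¹ ^ Module.finrank L⟮t⟯ K / t) ≤ 1 := by
    rw [map_div₀, map_pow]
    exact div_le_one_of_le₀ h1 zero_le
  have h3 := (Q.valuation_le_one_iff _).2 (hPQ ((P.valuation_le_one_iff _).1 h2))
  have h4 : Q.valuation (x⁻¹ ^ Module.finrank L⟮t⟯ K) < 1 := by
    have e : x⁻¹ ^ Module.finrank L⟮t⟯ K = (x⁻¹ ^ Module.finrank L⟮t⟯ K / t) * t := by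
      field_simp
    rw [e]
    exact Q.valuation_mul_lt_one h3 htQ
  have h5 : Q.valuation (x ^ Module.finrank L⟮t⟯ K) ≤ 1 := by
    rw [map_pow]
    exact pow_le_one' ((Q.valuation_le_one_iff _).2 hxQ) _
  have h6 := Q.valuation_mul_lt_one h5 h4
  rw [← mul_pow, mul_inv_cancel₀ hx0, one_pow, map_one] at h6
  exact lt_irrefl _ h6

variable (L) in
/-- The functions that are regular at all zeros of `t`. -/
def regularAtZeros (t : K) : Subalgebra L K where
  carrier := {x | ∀ Q : ValuationSubring K, ContainsConstants L Q → Q.valuation t < 1 →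
    Q.valuation x ≤ 1}
  mul_mem' := fun ha hb Q h1 h2 => by
    rw [map_mul]
    exact mul_le_one' (ha Q h1 h2) (hb Q h1 h2)
  add_mem' := fun ha hb Q h1 h2 => Valuation.map_add_le _ (ha Q h1 h2) (hb Q h1 h2)
  algebraMap_mem' := fun c _ h1 _ => h1.valuation_algebraMap_le c

variable (L) in
/-- The element `t` of the ring of functions regular at its zeros. -/
def regularAtZerosGen (t : K) : regularAtZeros L t := ⟨t, fun _ _ h => h.le⟩

theorem finite_primes_of_dependent {R : Type*} [CommRing R] [Algebra L R] {t : R} {n : ℕ}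
    (h : ∀ b : Fin (n + 1) → R, ∃ c : Fin (n + 1) → L, c ≠ 0 ∧ t ∣ ∑ i, c i • b i) :
    {𝔭 : Ideal R | 𝔭.IsPrime ∧ t ∈ 𝔭}.Finite := by
  classical
  set I : Ideal R := Ideal.span {t}
  have h1 : Module.rank L (R ⧸ I) ≤ n := by
    refine rank_le fun s hs => ?_
    by_contra! hlt
    obtain ⟨u, hus, hu⟩ := Finset.exists_subset_card_eq (Nat.succ_le_of_lt hlt)
    let e := u.equivFinOfCardEq hu
    choose b hb using fun i => Ideal.Quotient.mk_surjective (I := I) (e.symm i : R ⧸ I)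
    obtain ⟨c, hc, hdvd⟩ := h b
    have hind : LinearIndependent L (fun i => ((e.symm i : u) : R ⧸ I)) :=
      (hs.comp (fun i => (⟨e.symm i, hus (e.symm i).2⟩ : s)) fun i j hij => by
        simpa using hij)
    refine hc (funext fun i => linearIndependent_iff'.1 hind Finset.univ c ?_ i (Finset.mem_univ i))
    rw [← Ideal.mem_span_singleton, ← Ideal.Quotient.eq_zero_iff_mem, map_sum] at hdvd
    rw [← hdvd]
    refine Finset.sum_congr rfl fun i _ => ?_
    rw [← hb i]
    rfl
  have : Module.Finite L (R ⧸ I) := Module.rank_lt_aleph0_iff.1 (h1.trans_lt Cardinal.natCast_lt_aleph0)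
  have : IsArtinianRing (R ⧸ I) := IsArtinianRing.of_finite L _
  have : Finite (PrimeSpectrum (R ⧸ I)) := inferInstance
  refine (Set.finite_range
    (fun 𝔮 : PrimeSpectrum (R ⧸ I) => 𝔮.asIdeal.comap (Ideal.Quotient.mk I))).subset ?_
  rintro 𝔭 ⟨hp, ht⟩
  have hker : RingHom.ker (Ideal.Quotient.mk I) ≤ 𝔭 := by
    rwa [Ideal.mk_ker, Ideal.span_le, Set.singleton_subset_iff]
  refine ⟨⟨_, Ideal.map_isPrime_of_surjective Ideal.Quotient.mk_surjective hker⟩, ?_⟩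
  exact (Ideal.comap_map_of_surjective' _ Ideal.Quotient.mk_surjective 𝔭).trans (sup_eq_left.2 hker)

theorem finite_primes_regularAtZeros {t : K} (ht : Transcendental L t) [FiniteDimensional L⟮t⟯ K] :
    {𝔭 : Ideal (regularAtZeros L t) | 𝔭.IsPrime ∧ regularAtZerosGen L t ∈ 𝔭}.Finite := by
  refine finite_primes_of_dependent (L := L) (n := Module.finrank L⟮t⟯ K) fun b => ?_
  obtain ⟨p, hp, i, hi⟩ := exists_polynomial_relation ht (by simp)
    (fun i => (b i : K))
  refine ⟨fun i => (p i).coeff 0, fun h => hi (congrFun h i),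
    -(∑ i, aeval (regularAtZerosGen L t) (p i).divX * b i), ?_⟩
  apply Subtype.ext
  have h2 : ∀ q : L[X], ((aeval (regularAtZerosGen L t) q : regularAtZeros L t) : K) = aeval t q :=
    fun q => (Polynomial.aeval_algHom_apply (regularAtZeros L t).val (regularAtZerosGen L t) q).symm
  have h3 : ((regularAtZerosGen L t : regularAtZeros L t) : K) = t := rfl
  rw [MulMemClass.coe_mul, NegMemClass.coe_neg, AddSubmonoidClass.coe_finsetSum,
    AddSubmonoidClass.coe_finsetSum, h3, ← sub_eq_zero, mul_neg, sub_neg_eq_add,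
    ← hp, Finset.mul_sum, ← Finset.sum_add_distrib]
  refine Finset.sum_congr rfl fun i _ => ?_
  rw [aeval_eq_mul_divX_add t (p i), MulMemClass.coe_mul, h2, SetLike.val_smul, Algebra.smul_def]
  ring

/-- There is a function which is a unit at `P` and vanishes at all other zeros of `t`. -/
theorem exists_unit_vanishing_elsewhere {t : K} (ht : Transcendental L t) [FiniteDimensional L⟮t⟯ K]
    {P : ValuationSubring K} (hP : ContainsConstants L P) (htP : P.valuation t < 1) :
    ∃ w : K, P.valuation w = 1 ∧ ∀ Q : ValuationSubring K, ContainsConstants L Q → Q ≠ P →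
      Q.valuation t < 1 → Q.valuation w < 1 := by
  classical
  set R := regularAtZeros L t
  have hfin := finite_primes_regularAtZeros ht
  have hsep : ∀ 𝔮 : Ideal R, ∃ x : R, P.valuation (x : K) = 1 ∧
      ((∃ y ∈ 𝔮, P.valuation (y : K) = 1) → x ∈ 𝔮) := by
    intro 𝔮
    by_cases h : ∃ y ∈ 𝔮, P.valuation (y : K) = 1
    · obtain ⟨y, hy, hyP⟩ := h
      exact ⟨y, hyP, fun _ => hy⟩
    · exact ⟨1, by simp, fun h' => absurd h' h⟩
  choose x hxP hx using hsep
  refine ⟨((∏ 𝔮 ∈ hfin.toFinset, x 𝔮 : R) : K), ?_, fun Q hQ hQP htQ => ?_⟩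
  · rw [SubmonoidClass.coe_finsetProd, map_prod]
    exact Finset.prod_eq_one fun 𝔮 _ => hxP 𝔮
  have hle : ∀ y : R, (y : K) ∈ Q := fun y => (Q.valuation_le_one_iff _).1 (y.2 Q hQ htQ)
  let φ : R →+* Q := (R.val : R →+* K).codRestrict Q.toSubring hle
  let 𝔭 : Ideal R := (IsLocalRing.maximalIdeal Q).comap φ
  have hmem : ∀ y : R, y ∈ 𝔭 ↔ Q.valuation (y : K) < 1 := fun y =>
    (Q.valuation_lt_one_iff (φ y))
  have h𝔭 : 𝔭 ∈ hfin.toFinset := hfin.mem_toFinset.2 ⟨Ideal.IsPrime.comap φ, (hmem _).2 htQ⟩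
  obtain ⟨y, hyR, hyQ, hyP⟩ := exists_separating ht hP hQ htP htQ hQP
  rw [← hmem, ← Finset.mul_prod_erase _ _ h𝔭]
  exact Ideal.mul_mem_right _ _ (hx 𝔭 ⟨⟨y, hyR⟩, (hmem _).2 hyQ, hyP⟩)

theorem adjoin_simple_inv (f : K) : L⟮f⁻¹⟯ = L⟮f⟯ := by
  refine le_antisymm (adjoin_simple_le_iff.2 (inv_mem (mem_adjoin_simple_self L f)))
    (adjoin_simple_le_iff.2 ?_)
  simpa using inv_mem (mem_adjoin_simple_self L f⁻¹)

theorem Transcendental.inv {f : K} (hf : Transcendental L f) : Transcendental L f⁻¹ :=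
  fun h => hf (by simpa using h.inv)

variable (L) in
/-- The functions whose valuations are bounded by `β` at all valuation rings over `L`. -/
def boundSpace (β : ∀ Q : ValuationSubring K, Q.ValueGroup) : Submodule L K where
  carrier := {h | ∀ Q : ValuationSubring K, ContainsConstants L Q → Q.valuation h ≤ β Q}
  add_mem' := fun ha hb Q hQ => Valuation.map_add_le _ (ha Q hQ) (hb Q hQ)
  zero_mem' := fun Q _ => by rw [map_zero]; exact zero_le
  smul_mem' := fun c _ hx Q hQ => (hQ.valuation_smul_le c _).trans (hx Q hQ)

theorem mem_boundSpace {β : ∀ Q : ValuationSubring K, Q.ValueGroup} {h : K} :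
    h ∈ boundSpace L β ↔
      ∀ Q : ValuationSubring K, ContainsConstants L Q → Q.valuation h ≤ β Q := Iff.rfl

theorem codimLE_boundSpace {f : K} (hf : Transcendental L f) [FiniteDimensional L⟮f⟯ K]
    {β β' : ∀ Q : ValuationSubring K, Q.ValueGroup} {n e : ℕ} (y : Fin e → K)
    (hn : Module.finrank L⟮f⟯ K ≤ n + e)
    (hβ : ∀ Q : ValuationSubring K, ContainsConstants L Q → β' Q ≤ β Q ∨
      (1 < Q.valuation f ∧ β' Q ≤ Q.valuation f * β Q ∧ ∀ i, Q.valuation (y i) ≤ β Q))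
    (hy : ∀ r : Fin e → L, r ≠ 0 → ∃ P : ValuationSubring K, ContainsConstants L P ∧
      1 < P.valuation f ∧ ∃ B : P.ValueGroup, β' P ≤ B ∧ (∀ i, P.valuation (y i) ≤ B) ∧
      B < P.valuation f * P.valuation (∑ i, r i • y i)) :
    CodimLE (boundSpace L β) (boundSpace L β') n := by
  have ht : Transcendental L f⁻¹ := hf.inv
  have hfin : FiniteDimensional L⟮f⁻¹⟯ K := by rwa [adjoin_simple_inv]
  have hfr : Module.finrank L⟮f⁻¹⟯ K = Module.finrank L⟮f⟯ K := by rw [adjoin_simple_inv]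
  have hf0 : f ≠ 0 := fun h => hf (h ▸ isAlgebraic_zero)
  refine codimLE_of_dependent fun b hb => ?_
  obtain ⟨p, hp, i₀, hi₀⟩ := exists_polynomial_relation ht (ι := Fin (n + 1) ⊕ Fin e)
    (by rw [hfr]; simp; omega) (Sum.elim b y)
  rw [Fintype.sum_sum_type] at hp
  simp only [Sum.elim_inl, Sum.elim_inr] at hp
  set q : Fin (n + 1) → L[X] := fun i => p (Sum.inl i)
  set r : Fin e → L[X] := fun i => p (Sum.inr i)
  have hsmul : ∀ (s : L[X]) (z : K), aeval f⁻¹ s * z = s.coeff 0 • z + f⁻¹ * (aeval f⁻¹ s.divX * z) := by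
    intro s z
    rw [aeval_eq_mul_divX_add, Algebra.smul_def]
    ring
  refine ⟨fun i => (q i).coeff 0, fun hq0 => ?_, fun Q hQ => ?_⟩
  · -- all the constant coefficients of the `q i` vanish
    have hq0' : ∀ i, (q i).coeff 0 = 0 := fun i => congrFun hq0 i
    have hr0 : (fun i => (r i).coeff 0) ≠ 0 := by
      intro h
      cases i₀ with
      | inl i => exact hi₀ (hq0' i)
      | inr i => exact hi₀ (congrFun h i)
    obtain ⟨P, hP, hfP, B, hB₁, hB₂, hB₃⟩ := hy _ hr0
    have hvt : P.valuation f⁻¹ ≤ 1 := by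
      rw [map_inv₀]
      exact inv_le_one_of_one_le₀ hfP.le
    have h1 : f * ∑ i, (r i).coeff 0 • y i =
        -(∑ i, aeval f⁻¹ (q i).divX * b i + ∑ i, aeval f⁻¹ (r i).divX * y i) := by
      have h2 : ∀ i, aeval f⁻¹ (p (Sum.inl i)) * b i = f⁻¹ * (aeval f⁻¹ (q i).divX * b i) := fun i => by
        have := hsmul (q i) (b i)
        rwa [hq0' i, zero_smul, zero_add] at this
      have h3 : ∀ i, aeval f⁻¹ (p (Sum.inr i)) * y i = _ := fun i => hsmul (r i) (y i)
      rw [Finset.sum_congr rfl fun i _ => h2 i, Finset.sum_congr rfl fun i _ => h3 i,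
        Finset.sum_add_distrib, ← Finset.mul_sum, ← Finset.mul_sum] at hp
      have h4 : ∑ i, (r i).coeff 0 • y i = f⁻¹ *
          -(∑ i, aeval f⁻¹ (q i).divX * b i + ∑ i, aeval f⁻¹ (r i).divX * y i) := by
        linear_combination hp
      rw [h4, ← mul_assoc, mul_inv_cancel₀ hf0, one_mul]
    rw [← map_mul, h1, Valuation.map_neg] at hB₃
    refine absurd hB₃ (not_lt.2 ?_)
    refine Valuation.map_add_le _ (Valuation.map_sum_le _ fun i _ => ?_)
      (Valuation.map_sum_le _ fun i _ => ?_)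
    · rw [map_mul]
      exact (mul_le_of_le_one_left' (hP.valuation_aeval_le hvt _)).trans ((hb i P hP).trans hB₁)
    · rw [map_mul]
      exact (mul_le_of_le_one_left' (hP.valuation_aeval_le hvt _)).trans (hB₂ i)
  · rcases hβ Q hQ with h | ⟨hfQ, h₁, h₂⟩
    · exact (Valuation.map_sum_le _ fun i _ =>
        (hQ.valuation_smul_le _ _).trans (hb i Q hQ)).trans h
    have hvt : Q.valuation f⁻¹ ≤ 1 := by
      rw [map_inv₀]
      exact inv_le_one_of_one_le₀ hfQ.le
    have h1 : ∑ i, (q i).coeff 0 • b i =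
        -(∑ i, f⁻¹ * (aeval f⁻¹ (q i).divX * b i) + ∑ i, aeval f⁻¹ (r i) * y i) := by
      have h3 : ∀ i, aeval f⁻¹ (p (Sum.inl i)) * b i = _ := fun i => hsmul (q i) (b i)
      rw [Finset.sum_congr rfl fun i _ => h3 i, Finset.sum_add_distrib] at hp
      linear_combination hp
    rw [h1, Valuation.map_neg]
    refine Valuation.map_add_le _ (Valuation.map_sum_le _ fun i _ => ?_)
      (Valuation.map_sum_le _ fun i _ => ?_)
    · rw [map_mul, map_mul]
      have h3 : Q.valuation (aeval f⁻¹ (q i).divX) * Q.valuation (b i) ≤ Q.valuation f * β Q :=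
        (mul_le_of_le_one_left' (hQ.valuation_aeval_le hvt _)).trans ((hb i Q hQ).trans h₁)
      refine (mul_le_mul_right h3 _).trans ?_
      rw [← mul_assoc, ← map_mul, inv_mul_cancel₀ hf0, map_one, one_mul]
    · rw [map_mul]
      exact (mul_le_of_le_one_left' (hQ.valuation_aeval_le hvt _)).trans (h₂ i)

/-- The bound of a sum of pole divisors. -/
noncomputable def poleDivisorBound (m : Multiset K) (Q : ValuationSubring K) : Q.ValueGroup :=
  (m.map fun s => max 1 (Q.valuation s)).prod

theorem poleDivisorBound_cons (s : K) (m : Multiset K) (Q : ValuationSubring K) :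
    poleDivisorBound (s ::ₘ m) Q = max 1 (Q.valuation s) * poleDivisorBound m Q := by
  simp [poleDivisorBound]

theorem poleDivisorBound_add (m m' : Multiset K) (Q : ValuationSubring K) :
    poleDivisorBound (m + m') Q = poleDivisorBound m Q * poleDivisorBound m' Q := by
  simp [poleDivisorBound]

theorem poleDivisorBound_replicate (a : ℕ) (f : K) (Q : ValuationSubring K) :
    poleDivisorBound (Multiset.replicate a f) Q = max 1 (Q.valuation f) ^ a := by
  simp [poleDivisorBound]

theorem codimLE_poleDivisorBound {d : ℕ} (m m' : Multiset K)
    (hm : ∀ s ∈ m, Transcendental L s ∧ FiniteDimensional L⟮s⟯ K ∧ Module.finrank L⟮s⟯ K ≤ d) :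
    CodimLE (boundSpace L (poleDivisorBound m')) (boundSpace L (poleDivisorBound (m + m')))
      (m.card * d) := by
  induction m using Multiset.induction with
  | empty => exact .of_le (by rw [zero_add]) _
  | cons s m ih =>
    rw [Multiset.card_cons, Nat.succ_mul, Multiset.cons_add]
    refine (ih fun s hs => hm s (Multiset.mem_cons_of_mem hs)).trans ?_
    obtain ⟨h1, h2, h3⟩ := hm s (Multiset.mem_cons_self s m)
    refine codimLE_boundSpace h1 (e := 0) Fin.elim0 (by simpa using h3) (fun Q hQ => ?_) ?_
    · rw [poleDivisorBound_cons]
      rcases le_or_gt (Q.valuation s) 1 with h | h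
      · left
        rw [max_eq_left h, one_mul]
      · right
        rw [max_eq_right h.le]
        exact ⟨h, le_rfl, fun i => i.elim0⟩
    · exact fun r hr => absurd (Subsingleton.elim _ _) hr

theorem exists_valuation_lt_one {t : K} (ht : Transcendental L t) :
    ∃ Q : ValuationSubring K, ContainsConstants L Q ∧ Q.valuation t < 1 := by
  let A : Subalgebra L K := Algebra.adjoin L {t}
  let τ : A := ⟨t, Algebra.subset_adjoin rfl⟩
  have hI : Ideal.span {τ} ≠ ⊤ := by
    intro h
    rw [Ideal.eq_top_iff_one, Ideal.mem_span_singleton] at h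
    obtain ⟨u, hu⟩ := h
    obtain ⟨p, hp⟩ := (Algebra.adjoin_singleton_eq_range_aeval L t).le u.2
    change aeval t p = _ at hp
    have h1 : aeval t (X * p - 1) = 0 := by
      rw [map_sub, map_mul, aeval_X, hp, map_one, sub_eq_zero]
      exact (congrArg Subtype.val hu).symm
    have h2 := (transcendental_iff.1 ht) _ h1
    have h3 := congrArg (fun q : L[X] => q.coeff 0) h2
    simp at h3
  obtain ⟨Q, hAQ, hQ⟩ := Ideal.image_subset_nonunits_valuationSubring (A := A.toSubring)
    (Ideal.span {τ}) hI
  refine ⟨Q, fun c => hAQ (A.algebraMap_mem c), ?_⟩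
  have h1 : t ∈ Q.nonunits := hQ ⟨τ, Ideal.subset_span rfl, rfl⟩
  exact (Q.valuation_lt_one_iff ⟨t, hAQ τ.2⟩).1 (Q.mem_nonunits_iff_exists_mem_maximalIdeal.1 h1).2

theorem mem_range_algebraMap_of_valuation_le_one [IsAlgClosed L] {h : K}
    (hh : ∀ Q : ValuationSubring K, ContainsConstants L Q → Q.valuation h ≤ 1) :
    ∃ c : L, algebraMap L K c = h := by
  have halg : IsAlgebraic L h := by
    by_contra htr
    obtain ⟨Q, hQ, hlt⟩ := exists_valuation_lt_one (Transcendental.inv htr)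
    have h1 := Q.valuation_mul_lt_one (hh Q hQ) hlt
    rw [mul_inv_cancel₀ (fun h0 => htr (by rw [h0]; exact isAlgebraic_zero)),
      map_one] at h1
    exact lt_irrefl _ h1
  have h_integral : IsIntegral L h := halg.isIntegral
  exact minpoly.mem_range_of_degree_eq_one L h
    (IsAlgClosed.degree_eq_one_of_irreducible L (minpoly.irreducible h_integral))

open Classical in
/-- The bound allowing a pole of order `M` at `P` and no other poles. -/
noncomputable def singlePoleBound (P : ValuationSubring K) (π : K) (M : ℕ)
    (Q : ValuationSubring K) : Q.ValueGroup :=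
  if Q = P then (Q.valuation π ^ M)⁻¹ else 1

theorem mem_boundSpace_singlePoleBound {P : ValuationSubring K} (hP : ContainsConstants L P)
    {π h : K} (hπ0 : π ≠ 0) {M : ℕ} : h ∈ boundSpace L (singlePoleBound P π M) ↔
      (∀ Q : ValuationSubring K, ContainsConstants L Q → Q ≠ P → Q.valuation h ≤ 1) ∧
      P.valuation (π ^ M * h) ≤ 1 := by
  have key : ∀ Q : ValuationSubring K, Q.valuation h ≤ (Q.valuation π ^ M)⁻¹ ↔
      Q.valuation (π ^ M * h) ≤ 1 := by
    intro Q
    have hv : 0 < Q.valuation π ^ M := pow_pos (zero_lt_iff.2 ((Valuation.ne_zero_iff _).2 hπ0)) _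
    rw [map_mul, map_pow, ← mul_one (Q.valuation π ^ M)⁻¹, le_inv_mul_iff₀ hv]
  rw [mem_boundSpace]
  constructor
  · intro H
    refine ⟨fun Q hQ hne => ?_, ?_⟩
    · have := H Q hQ
      rwa [singlePoleBound, if_neg hne] at this
    · have := H P hP
      rwa [singlePoleBound, if_pos rfl, key] at this
  · rintro ⟨h1, h2⟩ Q hQ
    rw [singlePoleBound]
    split_ifs with hQP
    · subst hQP
      exact (key _).2 h2
    · exact h1 Q hQ hQP

theorem codimLE_singlePoleBound_succ {P : ValuationSubring K} (hP : ContainsConstants L P)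
    (hres : ∀ x : K, P.valuation x ≤ 1 → ∃ c : L, P.valuation (x - algebraMap L K c) < 1)
    {π : K} (hπ0 : π ≠ 0) (hπ : ∀ x, P.valuation x < 1 → P.valuation x ≤ P.valuation π) (M : ℕ) :
    CodimLE (boundSpace L (singlePoleBound P π M)) (boundSpace L (singlePoleBound P π (M + 1))) 1 := by
  have hvπ : 0 < P.valuation π := zero_lt_iff.2 ((Valuation.ne_zero_iff _).2 hπ0)
  refine codimLE_of_dependent fun b hb => ?_
  simp only [mem_boundSpace_singlePoleBound hP hπ0] at hb ⊢
  by_cases h0 : P.valuation (π ^ M * b 0) ≤ 1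
  · refine ⟨![1, 0], fun h => one_ne_zero (congrFun h 0), ?_⟩
    have e : ∑ i, (![1, 0] : Fin 2 → L) i • b i = b 0 := by
      simp only [Fin.sum_univ_two, Matrix.cons_val_zero, Matrix.cons_val_one, one_smul, zero_smul,
        add_zero]
    rw [e]
    exact ⟨(hb 0).1, h0⟩
  have hlow : ∀ z, P.valuation (π ^ (M + 1) * z) < 1 → P.valuation (π ^ M * z) ≤ 1 := by
    intro z hz
    have h1 := hπ _ hz
    rwa [pow_succ', mul_assoc, map_mul, mul_le_iff_le_one_right hvπ] at h1
  have h1 : P.valuation (π ^ (M + 1) * b 0) = 1 :=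
    le_antisymm (hb 0).2 (not_lt.1 fun h => h0 (hlow _ h))
  have hx : P.valuation (π ^ (M + 1) * b 1 / (π ^ (M + 1) * b 0)) ≤ 1 := by
    rw [map_div₀, h1, div_one]
    exact (hb 1).2
  have hne : π ^ (M + 1) * b 0 ≠ 0 := fun h => by simp [h] at h1
  obtain ⟨c, hc⟩ := hres _ hx
  refine ⟨![-c, 1], fun h => one_ne_zero (congrFun h 1), ?_, ?_⟩
  · intro Q hQ hQP
    refine Valuation.map_sum_le _ fun i _ => (hQ.valuation_smul_le _ _).trans ((hb i).1 Q hQ hQP)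
  · refine hlow _ ?_
    have e : π ^ (M + 1) * ∑ i, (![-c, 1] : Fin 2 → L) i • b i = (π ^ (M + 1) * b 0) *
        (π ^ (M + 1) * b 1 / (π ^ (M + 1) * b 0) - algebraMap L K c) := by
      rw [mul_sub, mul_div_cancel₀ _ hne]
      simp only [Fin.sum_univ_two, Matrix.cons_val_zero, Matrix.cons_val_one, one_smul, neg_smul,
        Algebra.smul_def c]
      ring
    exact e ▸ P.valuation_mul_lt_one h1.le hc

theorem codimLE_singlePoleBound [IsAlgClosed L] {P : ValuationSubring K} (hP : ContainsConstants L P)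
    (hres : ∀ x : K, P.valuation x ≤ 1 → ∃ c : L, P.valuation (x - algebraMap L K c) < 1)
    {π : K} (hπ0 : π ≠ 0) (hπ : ∀ x, P.valuation x < 1 → P.valuation x ≤ P.valuation π) (M : ℕ) :
    CodimLE ⊥ (boundSpace L (singlePoleBound P π M)) (M + 1) := by
  have h0 : CodimLE ⊥ (boundSpace L (singlePoleBound P π 0)) 1 := by
    refine ⟨{1}, by simp, fun h hh => ?_⟩
    rw [mem_boundSpace_singlePoleBound hP hπ0, pow_zero, one_mul] at hh
    obtain ⟨c, rfl⟩ := mem_range_algebraMap_of_valuation_le_one (L := L) (h := h) fun Q hQ => by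
      by_cases hQP : Q = P
      · subst hQP
        exact hh.2
      · exact hh.1 Q hQ hQP
    rw [bot_sup_eq, Algebra.algebraMap_eq_smul_one]
    exact Submodule.smul_mem _ _ (Submodule.subset_span (by simp))
  have h1 := CodimLE.iterate (codimLE_singlePoleBound_succ hP hres hπ0 hπ) 0 M
  have h2 := h0.trans h1
  rwa [zero_add, mul_one, add_comm] at h2

theorem ContainsConstants.exists_valuation_eq_pow {P : ValuationSubring K}
    (hP : ContainsConstants L P) {t π : K} (ht : Transcendental L t) [FiniteDimensional L⟮t⟯ K]
    (htP : P.valuation t < 1) (hπ0 : π ≠ 0) (hπ1 : P.valuation π < 1)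
    (hπ : ∀ x, P.valuation x < 1 → P.valuation x ≤ P.valuation π) :
    ∃ e, 1 ≤ e ∧ e ≤ Module.finrank L⟮t⟯ K ∧ P.valuation t = P.valuation π ^ e := by
  classical
  have hvπ : 0 < P.valuation π := zero_lt_iff.2 ((Valuation.ne_zero_iff _).2 hπ0)
  have hex : ∃ e, P.valuation π ^ e ≤ P.valuation t := ⟨_, hP.valuation_pow_finrank_le ht htP hπ1⟩
  have h1 := Nat.find_spec hex
  have h2 : Nat.find hex ≤ Module.finrank L⟮t⟯ K :=
    Nat.find_min' hex (hP.valuation_pow_finrank_le ht htP hπ1)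
  have h0 : Nat.find hex ≠ 0 := fun h => by
    rw [h, pow_zero] at h1
    exact absurd htP (not_lt.2 h1)
  obtain ⟨e, he⟩ := Nat.exists_eq_succ_of_ne_zero h0
  refine ⟨Nat.find hex, Nat.one_le_iff_ne_zero.2 h0, h2, le_antisymm ?_ h1⟩
  have h3 : P.valuation t < P.valuation π ^ e := not_le.1 (Nat.find_min hex (by omega))
  have h4 : P.valuation (t / π ^ e) < 1 := by
    rw [map_div₀, map_pow]
    exact (div_lt_one₀ (pow_pos hvπ _)).2 h3
  have h5 := hπ _ h4
  rw [he, pow_succ']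
  rwa [map_div₀, map_pow, div_le_iff₀ (pow_pos hvπ _)] at h5

theorem ContainsConstants.pow_lt_valuation_sum {P : ValuationSubring K}
    (hP : ContainsConstants L P) {π : K} (hπ0 : π ≠ 0) (hπ1 : P.valuation π < 1) {e : ℕ}
    {r : Fin e → L} (hr : r ≠ 0) :
    P.valuation π ^ e < P.valuation (∑ i, r i • π ^ (i : ℕ)) := by
  classical
  have hvπ : 0 < P.valuation π := zero_lt_iff.2 ((Valuation.ne_zero_iff _).2 hπ0)
  have hanti := pow_right_strictAnti₀ hvπ hπ1
  obtain ⟨i₁, hi₁⟩ := Function.ne_iff.1 hr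
  obtain ⟨i, hi, hmin⟩ := (Finset.univ.filter fun i => r i ≠ 0).exists_min_image id
    ⟨i₁, by simpa using hi₁⟩
  rw [Finset.mem_filter] at hi
  have hvi : P.valuation (r i • π ^ (i : ℕ)) = P.valuation π ^ (i : ℕ) := by
    rw [hP.valuation_smul hi.2, map_pow]
  have hlt : P.valuation (∑ j ∈ Finset.univ.erase i, r j • π ^ (j : ℕ)) <
      P.valuation (r i • π ^ (i : ℕ)) := by
    rw [hvi]
    refine Valuation.map_sum_lt _ (pow_pos hvπ _).ne' fun j hj => ?_
    by_cases h0 : r j = 0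
    · rw [h0, zero_smul, map_zero]
      exact pow_pos hvπ _
    · rw [hP.valuation_smul h0, map_pow]
      exact hanti (lt_of_le_of_ne (hmin j (by simpa using h0)) 
        fun h => Finset.ne_of_mem_erase hj (Fin.ext h.symm))
  rw [← Finset.add_sum_erase _ _ (Finset.mem_univ i), Valuation.map_add_eq_of_lt_left _ hlt, hvi]
  exact hanti i.2

open Classical in
/-- Interpolates between `singlePoleBound` and `poleDivisorBound`. -/
noncomputable def mixedBound (P : ValuationSubring K) (f : K) (a j : ℕ) (Q : ValuationSubring K) :
    Q.ValueGroup :=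
  if Q = P then Q.valuation f ^ a else max 1 (Q.valuation f) ^ j

theorem codimLE_mixedBound {P : ValuationSubring K} (hP : ContainsConstants L P) {f π : K}
    (hf : Transcendental L f) [FiniteDimensional L⟮f⟯ K] (hfP : 1 < P.valuation f)
    (hπ0 : π ≠ 0) (hπ1 : P.valuation π < 1) {e : ℕ} (he : P.valuation f⁻¹ = P.valuation π ^ e)
    (hed : e ≤ Module.finrank L⟮f⟯ K) (a j : ℕ) :
    CodimLE (boundSpace L (mixedBound P f a j)) (boundSpace L (mixedBound P f a (j + 1)))
      (Module.finrank L⟮f⟯ K - e) := by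
  classical
  have hvπ : 0 < P.valuation π := zero_lt_iff.2 ((Valuation.ne_zero_iff _).2 hπ0)
  have hvf : 0 < P.valuation f := zero_lt_one.trans hfP
  have ht : Transcendental L f⁻¹ := hf.inv
  have hfin : FiniteDimensional L⟮f⁻¹⟯ K := by rwa [adjoin_simple_inv]
  have htP : P.valuation f⁻¹ < 1 := by
    rw [map_inv₀]
    exact inv_lt_one_of_one_lt₀ hfP
  obtain ⟨w, hwP, hw⟩ := exists_unit_vanishing_elsewhere ht hP htP
  choose m hm using fun i : Fin e => exists_pow_mul_valuation_le (L := L) f⁻¹ (f ^ a * π ^ (i : ℕ))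
  set M := Module.finrank L⟮f⁻¹⟯ K * Finset.univ.sup m
  have hMw : ∀ Q : ValuationSubring K, ContainsConstants L Q → Q ≠ P → 1 < Q.valuation f → ∀ i : Fin e,
      Q.valuation (f ^ a * w ^ M * π ^ (i : ℕ)) ≤ 1 := by
    intro Q hQ hQP hfQ i
    have htQ : Q.valuation f⁻¹ < 1 := by
      rw [map_inv₀]
      exact inv_lt_one_of_one_lt₀ hfQ
    have h1 : Q.valuation (w ^ M) ≤ Q.valuation (f⁻¹ ^ m i) := by
      rw [map_pow, map_pow, pow_mul]
      calc _ ≤ Q.valuation f⁻¹ ^ Finset.univ.sup m :=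
            pow_le_pow_left' (hQ.valuation_pow_finrank_le ht htQ (hw Q hQ hQP htQ)) _
        _ ≤ _ := pow_le_pow_right_of_le_one' htQ.le (Finset.le_sup (Finset.mem_univ i))
    calc Q.valuation (f ^ a * w ^ M * π ^ (i : ℕ))
        = Q.valuation (w ^ M) * Q.valuation (f ^ a * π ^ (i : ℕ)) := by
          rw [← map_mul]
          congr 1
          ring
      _ ≤ Q.valuation (f⁻¹ ^ m i) * Q.valuation (f ^ a * π ^ (i : ℕ)) := mul_le_mul_left h1 _
      _ ≤ 1 := by
        rw [← map_mul]
        exact hm i Q hQ htQ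
  refine codimLE_boundSpace hf (fun i : Fin e => f ^ a * w ^ M * π ^ (i : ℕ)) (by omega)
    (fun Q hQ => ?_) fun r hr => ⟨P, hP, hfP, P.valuation f ^ a, ?_, fun i => ?_, ?_⟩
  · simp only [mixedBound]
    by_cases hQP : Q = P
    · left
      rw [if_pos hQP, if_pos hQP]
    · rw [if_neg hQP, if_neg hQP]
      rcases le_or_gt (Q.valuation f) 1 with h | h
      · left
        rw [max_eq_left h, one_pow, one_pow]
      · right
        rw [max_eq_right h.le, pow_succ']
        exact ⟨h, le_rfl, fun i => (hMw Q hQ hQP h i).trans (one_le_pow₀ h.le)⟩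
  · rw [mixedBound, if_pos rfl]
  · rw [map_mul, map_mul, map_pow, map_pow, map_pow, hwP, one_pow, mul_one]
    exact mul_le_of_le_one_right' (pow_le_one' hπ1.le _)
  · have e1 : ∑ i : Fin e, r i • (f ^ a * w ^ M * π ^ (i : ℕ)) =
        f ^ a * w ^ M * ∑ i : Fin e, r i • π ^ (i : ℕ) := by
      rw [Finset.mul_sum]
      exact Finset.sum_congr rfl fun i _ => (mul_smul_comm _ _ _).symm
    have h1 := hP.pow_lt_valuation_sum hπ0 hπ1 hr
    rw [e1, map_mul, map_mul, map_pow, map_pow, hwP, one_pow, mul_one, mul_left_comm]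
    refine lt_mul_of_one_lt_right (pow_pos hvf _) ?_
    rw [← he, map_inv₀, inv_lt_iff_one_lt_mul₀ hvf] at h1
    rwa [mul_comm] at h1

theorem codimLE_singlePoleBound_poleDivisorBound {P : ValuationSubring K}
    (hP : ContainsConstants L P) {f π : K}
    (hf : Transcendental L f) [FiniteDimensional L⟮f⟯ K] (hfP : 1 < P.valuation f)
    (hπ0 : π ≠ 0) (hπ1 : P.valuation π < 1) {e : ℕ} (he : P.valuation f⁻¹ = P.valuation π ^ e)
    (hed : e ≤ Module.finrank L⟮f⟯ K) (a : ℕ) :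
    CodimLE (boundSpace L (singlePoleBound P π (e * a)))
      (boundSpace L (poleDivisorBound (Multiset.replicate a f)))
      (a * (Module.finrank L⟮f⟯ K - e)) := by
  have h := CodimLE.iterate (codimLE_mixedBound hP hf hfP hπ0 hπ1 he hed a) 0 a
  have hf0 : f ≠ 0 := fun h => hf (h ▸ isAlgebraic_zero)
  have h0 : mixedBound P f a 0 = singlePoleBound P π (e * a) := by
    funext Q
    simp only [mixedBound, singlePoleBound]
    split_ifs with hQP
    · subst hQP
      rw [pow_mul, ← he, ← inv_pow, map_inv₀, inv_inv]
    · rw [pow_zero]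
  have h1 : mixedBound P f a (0 + a) = poleDivisorBound (Multiset.replicate a f) := by
    funext Q
    rw [poleDivisorBound_replicate]
    simp only [mixedBound]
    split_ifs with hQP
    · subst hQP
      rw [max_eq_right hfP.le]
    · rw [zero_add]
  rwa [h0, h1] at h

/-- A nonconstant function with poles only at `P`, of total order at most `d ^ 2`. -/
theorem exists_transcendental_singlePole [IsAlgClosed L] {P : ValuationSubring K}
    (hP : ContainsConstants L P)
    (hres : ∀ x : K, P.valuation x ≤ 1 → ∃ c : L, P.valuation (x - algebraMap L K c) < 1)
    {f π : K} (hf : Transcendental L f) [FiniteDimensional L⟮f⟯ K] (hfP : 1 < P.valuation f)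
    (hπ0 : π ≠ 0) (hπ1 : P.valuation π < 1)
    (hπ : ∀ x, P.valuation x < 1 → P.valuation x ≤ P.valuation π)
    {d : ℕ} (hd : Module.finrank L⟮f⟯ K = d) {m : Multiset K}
    (hm : ∀ s ∈ m, Transcendental L s ∧ FiniteDimensional L⟮s⟯ K ∧
      Module.finrank L⟮s⟯ K ≤ d) (hmc : m.card < d) {b : Fin d → K}
    (hb : LinearIndependent L⟮f⟯ b) (hbm : ∀ i, b i ∈ boundSpace L (poleDivisorBound m)) :
    ∃ h ∈ boundSpace L (singlePoleBound P π (d ^ 2)), Transcendental L h := by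
  classical
  by_contra! hcon
  have hcon' : ∀ h ∈ boundSpace L (singlePoleBound P π (d ^ 2)), ∃ c : L, algebraMap L K c = h := by
    intro h hh
    have h1 : IsIntegral L h := (not_not.1 (hcon h hh) : IsAlgebraic L h).isIntegral
    exact minpoly.mem_range_of_degree_eq_one L h
      (IsAlgClosed.degree_eq_one_of_irreducible L (minpoly.irreducible h1))
  have hfin : FiniteDimensional L⟮f⁻¹⟯ K := by rwa [adjoin_simple_inv]
  have htP : P.valuation f⁻¹ < 1 := by
    rw [map_inv₀]
    exact inv_lt_one_of_one_lt₀ hfP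
  obtain ⟨e, he1, hed, he⟩ := hP.exists_valuation_eq_pow hf.inv htP hπ0 hπ1 hπ
  rw [adjoin_simple_inv] at hed
  have c1 : CodimLE ⊥ (boundSpace L (singlePoleBound P π (d ^ 2))) 1 := by
    refine ⟨{1}, by simp, fun h hh => ?_⟩
    obtain ⟨c, rfl⟩ := hcon' h hh
    rw [bot_sup_eq, Algebra.algebraMap_eq_smul_one]
    exact Submodule.smul_mem _ _ (Submodule.subset_span (by simp))
  obtain ⟨u, hu⟩ : ∃ u, e * d ^ 2 = d ^ 2 + u :=
    ⟨e * d ^ 2 - d ^ 2, by have := Nat.mul_le_mul_right (d ^ 2) he1; omega⟩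
  have c2 := c1.trans (CodimLE.iterate (codimLE_singlePoleBound_succ hP hres hπ0 hπ) (d ^ 2) u)
  rw [← hu] at c2
  have c3 := (c2.trans (codimLE_singlePoleBound_poleDivisorBound hP hf hfP hπ0 hπ1 he hed
    (d ^ 2))).trans (codimLE_poleDivisorBound m _ hm)
  have hind := (linearIndependent_adjoin_iff hf b).1 hb
  have hcard := c3.card_le (b := fun p : Fin (d ^ 2 + 1) × Fin d => f ^ (p.1 : ℕ) * b p.2)
    (hind.comp (fun p : Fin (d ^ 2 + 1) × Fin d => ((p.1 : ℕ), p.2)) (by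
      rintro ⟨i, j⟩ ⟨i', j'⟩ h
      simp only [Prod.mk.injEq] at h
      exact Prod.ext (Fin.ext h.1) h.2)) (fun p Q hQ => ?_)
  · rw [Fintype.card_prod, Fintype.card_fin, Fintype.card_fin, hd] at hcard
    rw [hd] at hed
    obtain ⟨v, hv⟩ : ∃ v, d = e + v := ⟨d - e, by omega⟩
    have h1 : d - e = v := by omega
    rw [h1] at hcard
    have h2 : m.card * d + d ≤ d * d := by
      have := Nat.mul_le_mul_right d (Nat.succ_le_of_lt hmc)
      rw [Nat.succ_mul] at this
      exact this
    have h3 : d ^ 2 * d = e * d ^ 2 + d ^ 2 * v := by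
      rw [mul_comm e, ← mul_add, ← hv]
    nlinarith
  · rw [map_mul, map_pow, poleDivisorBound_add, poleDivisorBound_replicate, mul_comm]
    refine mul_le_mul' (hbm p.2 Q hQ) ?_
    calc _ ≤ max 1 (Q.valuation f) ^ (p.1 : ℕ) := pow_le_pow_left' (le_max_right _ _) _
      _ ≤ _ := pow_le_pow_right₀ (le_max_left _ _) (Nat.lt_succ_iff.1 p.1.2)

/-- The degree of a function with a pole of order at most `N` at `P` and no others. -/
theorem finrank_le_of_singlePole [IsAlgClosed L] {P : ValuationSubring K}
    (hP : ContainsConstants L P)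
    (hres : ∀ x : K, P.valuation x ≤ 1 → ∃ c : L, P.valuation (x - algebraMap L K c) < 1)
    {t π : K} [FiniteDimensional L⟮t⟯ K] (htP : P.valuation t < 1)
    (hπ0 : π ≠ 0) (hπ1 : P.valuation π < 1)
    (hπ : ∀ x, P.valuation x < 1 → P.valuation x ≤ P.valuation π) {e : ℕ}
    (he : P.valuation t = P.valuation π ^ e) {N : ℕ} {g : K} (hg : Transcendental L g)
    [FiniteDimensional L⟮g⟯ K] (hgN : g ∈ boundSpace L (singlePoleBound P π N)) :
    Module.finrank L⟮g⟯ K ≤ N := by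
  classical
  set n := Module.finrank L⟮g⟯ K with hn
  let b := Module.finBasis L⟮g⟯ K
  choose p hp0 hp using fun i => exists_aeval_mul_isIntegral (L := L) g (b i)
  have hpmem : ∀ i, aeval g (p i) ∈ L⟮g⟯ := fun i =>
    algebra_adjoin_le_adjoin L {g} (aeval_mem_adjoin_singleton L g)
  let y : Fin n → K := fun i => aeval g (p i) * b i
  have hy : LinearIndependent L⟮g⟯ y := by
    have := b.linearIndependent.units_smul fun i =>
      Units.mk0 (⟨aeval g (p i), hpmem i⟩ : L⟮g⟯) (fun h => hp0 i (congrArg Subtype.val h))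
    exact this
  have hind := (linearIndependent_adjoin_iff hg y).1 hy
  choose m hm using fun i => exists_pow_mul_valuation_le (L := L) t (y i)
  set c := e * Finset.univ.sup m
  rw [mem_boundSpace_singlePoleBound hP hπ0] at hgN
  have hyP : ∀ i, P.valuation (π ^ c * y i) ≤ 1 := by
    intro i
    refine le_trans ?_ (hm i P hP htP)
    rw [map_mul _ _ (y i), map_mul _ _ (y i), map_pow, map_pow, pow_mul, ← he]
    exact mul_le_mul_left (pow_le_pow_right_of_le_one' htP.le (Finset.le_sup (Finset.mem_univ i))) _
  have hcard := (codimLE_singlePoleBound hP hres hπ0 hπ (N * (c + 1) + c)).card_le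
    (b := fun q : Fin (c + 2) × Fin n => g ^ (q.1 : ℕ) * y q.2)
    (hind.comp (fun p : Fin (c + 2) × Fin n => ((p.1 : ℕ), p.2)) (by
      rintro ⟨i, j⟩ ⟨i', j'⟩ h
      simp only [Prod.mk.injEq] at h
      exact Prod.ext (Fin.ext h.1) h.2)) (fun q => ?_)
  · rw [Fintype.card_prod, Fintype.card_fin, Fintype.card_fin] at hcard
    by_contra! hlt
    have := Nat.mul_le_mul_left (c + 2) (Nat.succ_le_of_lt hlt)
    rw [Nat.succ_eq_add_one] at this
    nlinarith
  · rw [mem_boundSpace_singlePoleBound hP hπ0]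
    constructor
    · intro Q hQ hQP
      have hgQ := hgN.1 Q hQ hQP
      rw [map_mul, map_pow]
      exact mul_le_one' (pow_le_one' hgQ _) ((Q.valuation_le_one_iff _).2
        (hQ.mem_of_isIntegral ((Q.valuation_le_one_iff _).1 hgQ) (hp q.2)))
    · obtain ⟨u, hu⟩ : ∃ u, c + 1 = q.1 + u := ⟨c + 1 - q.1, by have := q.1.2; omega⟩
      have e1 : π ^ (N * (c + 1) + c) * (g ^ (q.1 : ℕ) * y q.2) =
          π ^ (N * u) * (π ^ N * g) ^ (q.1 : ℕ) * (π ^ c * y q.2) := by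
        rw [hu]
        ring
      rw [e1, map_mul, map_mul, map_pow, map_pow]
      exact mul_le_one' (mul_le_one' (pow_le_one' hπ1.le _) (pow_le_one' hgN.2 _)) (hyP _)

open scoped algebraAdjoinAdjoin in
theorem finiteDimensional_adjoin_of_transcendental {x g : K} [FiniteDimensional L⟮x⟯ K]
    (hg : Transcendental L g) : FiniteDimensional L⟮g⟯ K := by
  have : Algebra.IsAlgebraic (Algebra.adjoin L {x}) K := by
    exact (IsFractionRing.comap_isAlgebraic_iff (A := Algebra.adjoin L {x}) (K := L⟮x⟯)).2
      inferInstance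
  have h1 : AlgebraicIndependent L (fun _ : PUnit => g) :=
    algebraicIndependent_unique_type_iff.2 hg
  have h2 : Algebra.trdeg L K ≤ 1 := by
    have := Algebra.IsAlgebraic.trdeg_le_cardinalMk (R := L) (s := ({x} : Set K))
    simpa using this
  have h3 := h1.isTranscendenceBasis_of_trdeg_le_of_finite (by simpa using h2)
  have h4 := h3.isAlgebraic_field
  rw [Set.range_const] at h4
  have h5 : Algebra.EssFiniteType L L⟮x⟯ :=
    essFiniteType_iff.2 (fg_adjoin_of_finite (Set.finite_singleton x))
  have h6 : Algebra.EssFiniteType L K := Algebra.EssFiniteType.comp L L⟮x⟯ K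
  have h7 : Algebra.EssFiniteType L⟮g⟯ K := Algebra.EssFiniteType.of_comp L L⟮g⟯ K
  obtain ⟨S, hS⟩ := IntermediateField.fg_top (F := L⟮g⟯) (E := K)
  have h8 : FiniteDimensional L⟮g⟯ (adjoin L⟮g⟯ (S : Set K)) :=
    finiteDimensional_adjoin fun y _ => (Algebra.IsAlgebraic.isAlgebraic y).isIntegral
  rw [hS] at h8
  exact IntermediateField.topEquiv.toLinearEquiv.finiteDimensional

theorem exists_basis_boundSpace_of_intermediateField {S : Set K} {f : K} [FiniteDimensional L⟮f⟯ K]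
    (hS : adjoin L S = ⊤) (M : IntermediateField L⟮f⟯ K) {m : Multiset K} (hm : ∀ s ∈ m, s ∈ S)
    (hmc : m.card < Module.finrank L⟮f⟯ M) {ι : Type} [Fintype ι]
    (hι : Fintype.card ι = Module.finrank L⟮f⟯ M) {b : ι → M}
    (hb : LinearIndependent L⟮f⟯ b) (hbm : ∀ i, (b i : K) ∈ boundSpace L (poleDivisorBound m)) :
    ∃ m : Multiset K, (∀ s ∈ m, s ∈ S) ∧ m.card < Module.finrank L⟮f⟯ K ∧
      ∃ b : Fin (Module.finrank L⟮f⟯ K) → K, LinearIndependent L⟮f⟯ b ∧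
        ∀ i, b i ∈ boundSpace L (poleDivisorBound m) := by
  induction h : Module.finrank L⟮f⟯ K - Module.finrank L⟮f⟯ M using Nat.strong_induction_on
    generalizing M m ι with
  | _ r ih =>
  by_cases hSM : S ⊆ M
  · have hM : M = ⊤ := by
      rw [eq_top_iff]
      intro x _
      have h1 : adjoin L S ≤ M.restrictScalars L := adjoin_le_iff.2 hSM
      rw [hS] at h1
      exact h1 (mem_top : x ∈ ⊤)
    have h2 : Module.finrank L⟮f⟯ M = Module.finrank L⟮f⟯ K := by
      rw [hM, IntermediateField.finrank_top']
    refine ⟨m, hm, h2 ▸ hmc, fun i => b (Fintype.equivFinOfCardEq (hι.trans h2) |>.symm i),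
      ?_, fun i => hbm _⟩
    have := (hb.map' M.val.toLinearMap (LinearMap.ker_eq_bot.2 Subtype.val_injective)).comp _
      (Fintype.equivFinOfCardEq (hι.trans h2)).symm.injective
    exact this
  · obtain ⟨s, hsS, hsM⟩ := Set.not_subset.1 hSM
    have h_integral : IsIntegral M s := Algebra.IsIntegral.isIntegral s
    have he : 2 ≤ (minpoly M s).natDegree := by
      rw [minpoly.two_le_natDegree_iff h_integral]
      rintro ⟨y, rfl⟩
      exact hsM y.2
    set e := (minpoly M s).natDegree with hedef
    let M' : IntermediateField L⟮f⟯ K := restrictScalars L⟮f⟯ M⟮s⟯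
    have hfr : Module.finrank L⟮f⟯ M' = Module.finrank L⟮f⟯ M * e := by
      have h1 := Module.finrank_mul_finrank L⟮f⟯ M M⟮s⟯
      rw [adjoin.finrank h_integral] at h1
      exact h1.symm
    have hpos : 0 < Module.finrank L⟮f⟯ M := Module.finrank_pos
    have hle : Module.finrank L⟮f⟯ M' ≤ Module.finrank L⟮f⟯ K :=
      Submodule.finrank_le (Subalgebra.toSubmodule M'.toSubalgebra)
    have hlt : Module.finrank L⟮f⟯ M < Module.finrank L⟮f⟯ M' := by rw [hfr]; nlinarith
    have hmem : ∀ p : ι × Fin e, (b p.1 : K) * s ^ (p.2 : ℕ) ∈ M' := fun p =>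
      mul_mem (show ((b p.1 : M) : K) ∈ M⟮s⟯ from IntermediateField.algebraMap_mem M⟮s⟯ (b p.1))
        (pow_mem (mem_adjoin_simple_self M s) _)
    refine @ih _ ?_ M' (m + Multiset.replicate (e - 1) s) ?_ ?_ (ι × Fin e) _ ?_
      (fun p => ⟨(b p.1 : K) * s ^ (p.2 : ℕ), hmem p⟩) ?_ ?_ rfl
    · omega
    · intro y hy
      rcases Multiset.mem_add.1 hy with hy | hy
      · exact hm y hy
      · rw [Multiset.eq_of_mem_replicate hy]
        exact hsS
    · rw [Multiset.card_add, Multiset.card_replicate, hfr]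
      obtain ⟨u, hu⟩ : ∃ u, e = u + 1 := ⟨e - 1, by omega⟩
      rw [hu, Nat.add_sub_cancel]
      nlinarith
    · rw [Fintype.card_prod, Fintype.card_fin, hι, hfr]
    · have h1 := linearIndependent_smul hb (linearIndependent_pow (K := M) s)
      refine LinearIndependent.of_comp M'.val.toLinearMap ?_
      exact h1
    · rintro p Q hQ
      show Q.valuation ((b p.1 : K) * s ^ (p.2 : ℕ)) ≤ _
      rw [map_mul, map_pow, poleDivisorBound_add, poleDivisorBound_replicate]
      refine mul_le_mul' (hbm p.1 Q hQ) ?_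
      calc _ ≤ max 1 (Q.valuation s) ^ (p.2 : ℕ) := pow_le_pow_left' (le_max_right _ _) _
        _ ≤ _ := pow_le_pow_right₀ (le_max_left _ _) (by have := p.2.2; omega)

/-- Let `S` generate `K` over `L` and `f ∈ K` with `[K : L(f)]` finite. Then `K` has a basis over
`L(f)` consisting of products of fewer than `[K : L(f)]` elements of `S`. -/
theorem exists_basis_boundSpace {S : Set K} {f : K} [FiniteDimensional L⟮f⟯ K]
    (hS : adjoin L S = ⊤) :
    ∃ m : Multiset K, (∀ s ∈ m, s ∈ S) ∧ m.card < Module.finrank L⟮f⟯ K ∧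
      ∃ b : Fin (Module.finrank L⟮f⟯ K) → K, LinearIndependent L⟮f⟯ b ∧
        ∀ i, b i ∈ boundSpace L (poleDivisorBound m) := by
  refine exists_basis_boundSpace_of_intermediateField hS ⊥ (m := 0) (by simp) (by simp)
    (ι := Unit) (by simp) (b := fun _ => 1) (LinearIndependent.of_subsingleton () one_ne_zero) ?_
  intro i Q _
  simp [poleDivisorBound]

/-- If `K` is generated over the algebraically closed field `L` by functions of degree `d`, then
there are nonconstant functions with a single pole at `P` of order at most `d ^ 2`, and these
have degree at most `d ^ 2`. -/
theorem exists_singlePole_degree_le [IsAlgClosed L] {P : ValuationSubring K}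
    (hP : ContainsConstants L P)
    (hres : ∀ x : K, P.valuation x ≤ 1 → ∃ c : L, P.valuation (x - algebraMap L K c) < 1)
    {S : Set K} (hS : adjoin L S = ⊤) (hne : S.Nonempty) {d : ℕ}
    (hSd : ∀ s ∈ S, Transcendental L s ∧ FiniteDimensional L⟮s⟯ K ∧ Module.finrank L⟮s⟯ K = d) :
    ∃ γ : K, γ ≠ 0 ∧
      (∃ h, Transcendental L h ∧ (∀ Q : ValuationSubring K, ContainsConstants L Q → Q ≠ P →
        Q.valuation h ≤ 1) ∧ P.valuation h ≤ P.valuation γ) ∧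
      ∀ h, Transcendental L h → (∀ Q : ValuationSubring K, ContainsConstants L Q → Q ≠ P →
        Q.valuation h ≤ 1) → P.valuation h ≤ P.valuation γ →
        FiniteDimensional L⟮h⟯ K ∧ Module.finrank L⟮h⟯ K ≤ d ^ 2 := by
  obtain ⟨f, hf, hfin, hfd, hfP⟩ : ∃ f, Transcendental L f ∧ FiniteDimensional L⟮f⟯ K ∧
      Module.finrank L⟮f⟯ K = d ∧ 1 < P.valuation f := by
    obtain ⟨f, hfS⟩ := hne
    obtain ⟨hf, hfin, hfd⟩ := hSd f hfS
    rcases lt_or_ge 1 (P.valuation f) with h | h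
    · exact ⟨f, hf, hfin, hfd, h⟩
    · obtain ⟨c, hc⟩ := hres f h
      have ht : Transcendental L (f - algebraMap L K c) := fun h => hf <| by
        simpa using h.add (isAlgebraic_algebraMap c)
      have had : L⟮(f - algebraMap L K c)⁻¹⟯ = L⟮f⟯ := by
        rw [adjoin_simple_inv]
        refine le_antisymm ?_ ?_
        · rw [adjoin_simple_le_iff]
          exact sub_mem (mem_adjoin_simple_self L f) (IntermediateField.algebraMap_mem _ c)
        · rw [adjoin_simple_le_iff]
          simpa using add_mem (mem_adjoin_simple_self L (f - algebraMap L K c))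
            (IntermediateField.algebraMap_mem L⟮f - algebraMap L K c⟯ c)
      refine ⟨(f - algebraMap L K c)⁻¹, ht.inv, by rwa [had], by rwa [had], ?_⟩
      rw [map_inv₀, one_lt_inv₀]
      · exact hc
      · exact zero_lt_iff.2 ((Valuation.ne_zero_iff _).2 fun h0 => ht (h0 ▸ isAlgebraic_zero))
  have hfin' : FiniteDimensional L⟮f⁻¹⟯ K := by rwa [adjoin_simple_inv]
  have htP : P.valuation f⁻¹ < 1 := by
    rw [map_inv₀]
    exact inv_lt_one_of_one_lt₀ hfP
  obtain ⟨π, hπ0, hπ1, hπ⟩ := hP.exists_uniformizer hf.inv htP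
  obtain ⟨e, -, -, he⟩ := hP.exists_valuation_eq_pow hf.inv htP hπ0 hπ1 hπ
  have hvπ : 0 < P.valuation π ^ d ^ 2 := pow_pos (zero_lt_iff.2 ((Valuation.ne_zero_iff _).2 hπ0)) _
  have hiff : ∀ h : K, P.valuation h ≤ P.valuation (π ^ d ^ 2)⁻¹ ↔
      P.valuation (π ^ d ^ 2 * h) ≤ 1 := fun h => by
    rw [map_inv₀, map_mul, map_pow, ← one_div, le_div_iff₀ hvπ, mul_comm]
  refine ⟨(π ^ d ^ 2)⁻¹, inv_ne_zero (pow_ne_zero _ hπ0), ?_, ?_⟩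
  · obtain ⟨m, hm, hmc, b, hb, hbm⟩ := exists_basis_boundSpace (f := f) hS
    obtain ⟨h, hh, hht⟩ := exists_transcendental_singlePole hP hres hf hfP hπ0 hπ1 hπ rfl
      (fun s hs => (⟨(hSd s (hm s hs)).1, (hSd s (hm s hs)).2.1,
        ((hSd s (hm s hs)).2.2.trans hfd.symm).le⟩)) hmc hb hbm
    rw [hfd, mem_boundSpace_singlePoleBound hP hπ0] at hh
    exact ⟨h, hht, hh.1, (hiff h).2 hh.2⟩
  · intro h hh h1 h2
    have h3 : FiniteDimensional L⟮h⟯ K := finiteDimensional_adjoin_of_transcendental (x := f) hh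
    exact ⟨h3, finrank_le_of_singlePole hP hres htP hπ0 hπ1 hπ he hh
      ((mem_boundSpace_singlePoleBound hP hπ0).2 ⟨h1, (hiff h).1 h2⟩)⟩

end

section

open scoped TensorProduct

variable {L K L' K' : Type*} [Field L] [Field K] [Algebra L K] [Field L'] [Field K'] [Algebra L' K']

theorem finrank_adjoin_le_of_span {i : L →+* L'} {j : K →+* K'}
    (hij : ∀ a, j (algebraMap L K a) = algebraMap L' K' (i a))
    (hspan : Submodule.span L' (Set.range j) = ⊤) (f : K) [FiniteDimensional L⟮f⟯ K] :
    FiniteDimensional L'⟮j f⟯ K' ∧ Module.finrank L'⟮j f⟯ K' ≤ Module.finrank L⟮f⟯ K := by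
  let b := Module.finBasis L⟮f⟯ K
  have hle : L⟮f⟯.toSubfield ≤ L'⟮j f⟯.toSubfield.comap j := by
    intro x hx
    refine adjoin_induction (s := {f}) L (p := fun x _ => j x ∈ L'⟮j f⟯) ?_ ?_ ?_ ?_ ?_ hx
    · rintro x rfl
      exact mem_adjoin_simple_self L' _
    · intro a
      rw [hij]
      exact IntermediateField.algebraMap_mem _ _
    · intro x y _ _ hx hy
      rw [map_add]
      exact add_mem hx hy
    · intro x _ hx
      rw [map_inv₀]
      exact inv_mem hx
    · intro x y _ _ hx hy
      rw [map_mul]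
      exact mul_mem hx hy
  have htop : Submodule.span L'⟮j f⟯ (Set.range (j ∘ b)) = ⊤ := by
    rw [eq_top_iff]
    have h1 : Submodule.span L' (Set.range j) ≤
        (Submodule.span L'⟮j f⟯ (Set.range (j ∘ b))).restrictScalars L' := by
      rw [Submodule.span_le]
      rintro _ ⟨x, rfl⟩
      rw [← b.sum_repr x, map_sum]
      refine sum_mem fun c _ => ?_
      let a : L'⟮j f⟯ := ⟨j (b.repr x c), hle (b.repr x c).2⟩
      have h2 : j (b.repr x c • b c) = a • (j ∘ b) c := map_mul j _ _
      rw [h2]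
      exact Submodule.smul_mem _ _ (Submodule.subset_span (Set.mem_range_self c))
    rw [hspan] at h1
    exact fun x _ => h1 (Submodule.mem_top : x ∈ ⊤)
  classical
  refine ⟨⟨⟨Finset.univ.image (j ∘ b), by
    rw [Finset.coe_image, Finset.coe_univ, Set.image_univ, htop]⟩⟩, ?_⟩
  simpa using finrank_le_of_span_eq_top htop

theorem finrank_adjoin_le_of_linearIndependent (j : K →+* K') {f : K} (hf : Transcendental L f)
    (hf' : Transcendental L' (j f)) [FiniteDimensional L'⟮j f⟯ K']
    (hj : ∀ (n : ℕ) (v : ℕ × Fin n → K), LinearIndependent L v → LinearIndependent L' (j ∘ v)) :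
    Module.finrank L⟮f⟯ K ≤ Module.finrank L'⟮j f⟯ K' := by
  rcases Nat.eq_zero_or_pos (Module.finrank L⟮f⟯ K) with h0 | hpos
  · rw [h0]
    exact Nat.zero_le _
  have : FiniteDimensional L⟮f⟯ K := Module.finite_of_finrank_pos hpos
  let b := Module.finBasis L⟮f⟯ K
  have h1 := hj _ _ ((linearIndependent_adjoin_iff hf b).1 b.linearIndependent)
  have h2 : LinearIndependent L'⟮j f⟯ (j ∘ b) := by
    rw [linearIndependent_adjoin_iff hf']
    convert h1 using 2 with p
    simp
  simpa using h2.fintype_card_le_finrank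

theorem Transcendental.map_of_isAlgebraic {i : L →+* L'} {j : K →+* K'}
    (hij : ∀ a, j (algebraMap L K a) = algebraMap L' K' (i a))
    (hi : ∀ a : L', letI := i.toAlgebra; IsAlgebraic L a) {f : K} (hf : Transcendental L f) :
    Transcendental L' (j f) := by
  let := i.toAlgebra
  let : Algebra L K' := ((algebraMap L' K').comp i).toAlgebra
  have : IsScalarTower L L' K' := IsScalarTower.of_algebraMap_eq fun _ => rfl
  have : Algebra.IsAlgebraic L L' := ⟨hi⟩
  intro h
  have h1 : IsAlgebraic L (j f) := h.restrictScalars L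
  let J : K →ₐ[L] K' := { j with commutes' := hij }
  exact hf ((isAlgebraic_algHom_iff J J.toRingHom.injective).1 h1)

theorem finrank_adjoin_coe_mul_finrank (M : IntermediateField L K) (s : M) :
    Module.finrank L⟮s⟯ M * Module.finrank M K = Module.finrank L⟮(s : K)⟯ K := by
  rw [Module.finrank_mul_finrank]
  let i : L⟮s⟯ ≃ₐ[L] L⟮(s : K)⟯ :=
    (liftAlgEquiv L⟮s⟯).trans (equivOfEq (lift_adjoin_simple L M s))
  refine Algebra.finrank_eq_of_equiv_equiv i.toRingEquiv (RingEquiv.refl K) ?_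
  rfl

theorem isField_tensorProduct (k F L : Type*) [Field k] [Field F] [Algebra k F] [Field L]
    [Algebra k L] [Algebra.IsAlgebraic k L] [IsDomain (L ⊗[k] F)] : IsField (L ⊗[k] F) := by
  let e := (Algebra.TensorProduct.comm k F L).toMulEquiv
  have : IsDomain (F ⊗[k] L) := e.isDomain _
  exact MulEquiv.isField (isField_of_isIntegral_of_isField' (R := F) (Field.toIsField F)) e.symm

end

section

open scoped TensorProduct

variable {k F Ω E : Type*} [Field k] [Field F] [Algebra k F] [Field Ω] [Algebra k Ω] [Field E]
  [Algebra Ω E]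

/-- The embedding of `F` into its constant field extension `E = Ω ⊗ F`. -/
def constantExtensionMap (φ : Ω ⊗[k] F ≃ₐ[Ω] E) : F →+* E :=
  (φ : Ω ⊗[k] F →+* E).comp (Algebra.TensorProduct.includeRight : F →ₐ[k] Ω ⊗[k] F).toRingHom

variable (φ : Ω ⊗[k] F ≃ₐ[Ω] E)

theorem apply_tmul (a : Ω) (x : F) :
    φ (a ⊗ₜ x) = algebraMap Ω E a * constantExtensionMap φ x := by
  rw [← Algebra.smul_def]
  change _ = a • φ (1 ⊗ₜ x)
  rw [← map_smul, TensorProduct.smul_tmul', smul_eq_mul, mul_one]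

theorem constantExtensionMap_algebraMap (a : k) :
    constantExtensionMap φ (algebraMap k F a) = algebraMap Ω E (algebraMap k Ω a) := by
  change φ (1 ⊗ₜ algebraMap k F a) = _
  rw [← φ.commutes, Algebra.TensorProduct.algebraMap_apply, Algebra.algebraMap_self_apply,
    Algebra.algebraMap_eq_smul_one, Algebra.algebraMap_eq_smul_one, TensorProduct.smul_tmul]

/-- A basis of `F` over `k` is a basis of `E` over `Ω`. -/
noncomputable def constantExtensionBasis {ι : Type*} (B : Module.Basis ι k F) :
    Module.Basis ι Ω E := (Algebra.TensorProduct.basis Ω B).map φ.toLinearEquiv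

theorem constantExtensionBasis_apply {ι : Type*} (B : Module.Basis ι k F) (i : ι) :
    constantExtensionBasis φ B i = constantExtensionMap φ (B i) := by
  change φ (Algebra.TensorProduct.basis Ω B i) = _
  rw [Algebra.TensorProduct.basis_apply]
  rfl

theorem span_range_constantExtensionMap :
    Submodule.span Ω (Set.range (constantExtensionMap φ)) = ⊤ := by
  let B := Module.Basis.ofVectorSpace k F
  rw [eq_top_iff, ← (constantExtensionBasis φ B).span_eq]
  refine Submodule.span_mono ?_
  rintro _ ⟨i, rfl⟩
  exact ⟨_, (constantExtensionBasis_apply φ B i).symm⟩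

theorem linearIndependent_constantExtensionMap {ι : Type*} {v : ι → F}
    (hv : LinearIndependent k v) : LinearIndependent Ω (constantExtensionMap φ ∘ v) := by
  let B := Module.Basis.extend hv.linearIndepOn_id
  have h := (constantExtensionBasis φ B).linearIndependent
  let r : ι → hv.linearIndepOn_id.extend (Set.subset_univ _) := fun i =>
    ⟨v i, hv.linearIndepOn_id.subset_extend _ ⟨i, rfl⟩⟩
  have hr : Function.Injective r := fun i j hij => hv.injective (congrArg Subtype.val hij)
  convert h.comp r hr using 1
  funext i
  rw [Function.comp_apply, Function.comp_apply, constantExtensionBasis_apply,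
    Module.Basis.extend_apply_self]

theorem exists_sum_constantExtensionMap {ι : Type*} (C : Module.Basis ι k Ω) (x : E) :
    ∃ y : ι →₀ F, x = y.sum fun i z => algebraMap Ω E (C i) * constantExtensionMap φ z := by
  obtain ⟨x, rfl⟩ := φ.surjective x
  induction x with
  | zero => exact ⟨0, by simp⟩
  | add x y hx hy =>
    obtain ⟨y₁, h₁⟩ := hx
    obtain ⟨y₂, h₂⟩ := hy
    refine ⟨y₁ + y₂, ?_⟩
    rw [map_add, h₁, h₂, Finsupp.sum_add_index'] <;> intros <;> simp [mul_add]
  | tmul a z =>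
    refine ⟨(C.repr a).mapRange (fun c => c • z) (zero_smul _ _), ?_⟩
    rw [Finsupp.sum_mapRange_index (by simp)]
    conv_lhs => rw [← C.linearCombination_repr a, Finsupp.linearCombination_apply, Finsupp.sum,
      TensorProduct.sum_tmul, map_sum]
    refine Finset.sum_congr rfl fun i _ => ?_
    rw [TensorProduct.smul_tmul]
    exact apply_tmul φ _ _

theorem exists_galois_action (σ : Ω ≃ₐ[k] Ω) :
    ∃ τ : E ≃+* E, (∀ a, τ (algebraMap Ω E a) = algebraMap Ω E (σ a)) ∧
      ∀ x, τ (constantExtensionMap φ x) = constantExtensionMap φ x := by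
  let τ₀ : Ω ⊗[k] F ≃ₐ[k] Ω ⊗[k] F := Algebra.TensorProduct.congr σ AlgEquiv.refl
  refine ⟨(φ.symm.toRingEquiv.trans τ₀.toRingEquiv).trans φ.toRingEquiv, fun a => ?_, fun x => ?_⟩
  · change φ (τ₀ (φ.symm (algebraMap Ω E a))) = _
    rw [φ.symm.commutes, ← φ.commutes]
    congr 1
  · change φ (τ₀ (φ.symm (φ (1 ⊗ₜ x)))) = φ (1 ⊗ₜ x)
    rw [φ.symm_apply_apply]
    congr 1
    simp [τ₀]

end

section

open scoped TensorProduct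

variable {k F Ω E : Type*} [Field k] [Field F] [Algebra k F] [Field Ω] [Algebra k Ω] [Field E]
  [Algebra Ω E] (φ : Ω ⊗[k] F ≃ₐ[Ω] E)

/-- The valuation subring `Q` of the constant field extension `E` contains the constants and
dominates the valuation subring `P` of `F`. -/
structure LiesOver (P : ValuationSubring F) (Q : ValuationSubring E) : Prop where
  containsConstants : ContainsConstants Ω Q
  mem : ∀ x ∈ P, constantExtensionMap φ x ∈ Q
  valuation_lt_one : ∀ x, P.valuation x < 1 → Q.valuation (constantExtensionMap φ x) < 1

variable {φ} {P : ValuationSubring F}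

theorem LiesOver.mem_iff {Q : ValuationSubring E} (hQ : LiesOver φ P Q) (x : F) :
    constantExtensionMap φ x ∈ Q ↔ x ∈ P := by
  refine ⟨fun h => ?_, hQ.mem x⟩
  by_contra hx
  rw [← ValuationSubring.valuation_le_one_iff, not_le] at hx
  have h1 := hQ.valuation_lt_one x⁻¹ (by rw [map_inv₀]; exact inv_lt_one_of_one_lt₀ hx)
  rw [← ValuationSubring.valuation_le_one_iff] at h
  have h2 := Q.valuation_mul_lt_one h h1
  rw [← map_mul, mul_inv_cancel₀, map_one, map_one] at h2
  · exact lt_irrefl _ h2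
  · rintro rfl
    simp at hx

variable (φ) in
theorem exists_liesOver [Algebra.IsAlgebraic k Ω] (hk : ∀ a, algebraMap k F a ∈ P) :
    ∃ Q : ValuationSubring E, LiesOver φ P Q := by
  let j := constantExtensionMap φ
  let e : P ≃+* P.toSubring.map j := P.toSubring.equivMapOfInjective j j.injective
  let I : Ideal (P.toSubring.map j) := (IsLocalRing.maximalIdeal P).comap (e.symm : _ →+* P)
  have hI : I ≠ ⊤ := Ideal.comap_ne_top _ (IsLocalRing.maximalIdeal.isMaximal P).ne_top
  obtain ⟨Q, hPQ, hQ⟩ := Ideal.image_subset_nonunits_valuationSubring I hI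
  have hmem : ∀ x ∈ P, j x ∈ Q := fun x hx => hPQ ⟨x, hx, rfl⟩
  refine ⟨Q, fun c => ?_, hmem, fun x hx => ?_⟩
  · have h1 : IsIntegral k c := (Algebra.IsAlgebraic.isAlgebraic c).isIntegral
    let := ((algebraMap Ω E).comp (algebraMap k Ω)).toAlgebra
    have h2 : IsIntegral k (algebraMap Ω E c) :=
      h1.map ({ algebraMap Ω E with commutes' := fun _ => rfl } : Ω →ₐ[k] E)
    refine ContainsConstants.mem_of_isIntegral (L := k) (fun a => ?_) (zero_mem Q) h2.tower_top
    change algebraMap Ω E (algebraMap k Ω a) ∈ Q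
    rw [← constantExtensionMap_algebraMap φ]
    exact hmem _ (hk a)
  · have hxP : x ∈ P := (P.valuation_le_one_iff x).1 hx.le
    have h1 : j x ∈ Q.nonunits := by
      refine hQ ⟨e ⟨x, hxP⟩, ?_, rfl⟩
      change e.symm (e ⟨x, hxP⟩) ∈ IsLocalRing.maximalIdeal P
      rw [e.symm_apply_apply]
      exact (P.valuation_lt_one_iff _).2 hx
    exact (Q.valuation_lt_one_iff ⟨j x, hmem x hxP⟩).1
      (Q.mem_nonunits_iff_exists_mem_maximalIdeal.1 h1).2

variable (φ) in
theorem exists_valuation_sub_lt_one (hres : ∀ x ∈ P, ∃ a : k, P.valuation (x - algebraMap k F a) < 1)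
    {x : E} (hx : x ≠ 0) : ∃ x₀ : F, x₀ ≠ 0 ∧ ∃ c : Ω, c ≠ 0 ∧ ∀ Q, LiesOver φ P Q →
      Q.valuation (x / constantExtensionMap φ x₀ - algebraMap Ω E c) < 1 := by
  classical
  let C := Module.Basis.ofVectorSpace k Ω
  obtain ⟨y, rfl⟩ := exists_sum_constantExtensionMap φ C x
  have hy : y.support.Nonempty := by
    rw [Finsupp.support_nonempty_iff]
    rintro rfl
    simp at hx
  obtain ⟨i₀, hi₀, hmax⟩ := y.support.exists_max_image (fun i => P.valuation (y i)) hy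
  have h0 : y i₀ ≠ 0 := Finsupp.mem_support_iff.1 hi₀
  have hv0 : 0 < P.valuation (y i₀) := zero_lt_iff.2 ((Valuation.ne_zero_iff _).2 h0)
  have hmem : ∀ i ∈ y.support, y i / y i₀ ∈ P := fun i hi => by
    rw [← ValuationSubring.valuation_le_one_iff, map_div₀, div_le_one₀ hv0]
    exact hmax i hi
  have : ∀ i, ∃ a : k, i ∈ y.support → P.valuation (y i / y i₀ - algebraMap k F a) < 1 := fun i => by
    by_cases hi : i ∈ y.support
    · obtain ⟨a, ha⟩ := hres _ (hmem i hi)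
      exact ⟨a, fun _ => ha⟩
    · exact ⟨0, fun h => absurd h hi⟩
  choose a ha using this
  refine ⟨y i₀, h0, ∑ i ∈ y.support, a i • C i, ?_, fun Q hQ => ?_⟩
  · intro h
    have h1 := linearIndependent_iff'.1 C.linearIndependent _ _ h i₀ hi₀
    have h2 := ha i₀ hi₀
    rw [h1, div_self h0, map_zero, sub_zero, map_one] at h2
    exact lt_irrefl _ h2
  · rw [Finsupp.sum, Finset.sum_div, map_sum, ← Finset.sum_sub_distrib]
    refine Valuation.map_sum_lt _ one_ne_zero fun i hi => ?_
    have h1 : algebraMap Ω E (C i) * constantExtensionMap φ (y i) / constantExtensionMap φ (y i₀) -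
        algebraMap Ω E (a i • C i) = algebraMap Ω E (C i) *
          constantExtensionMap φ (y i / y i₀ - algebraMap k F (a i)) := by
      rw [map_sub, constantExtensionMap_algebraMap, map_div₀, Algebra.smul_def, map_mul]
      ring
    rw [h1]
    exact Q.valuation_mul_lt_one (hQ.containsConstants.valuation_algebraMap_le _)
      (hQ.valuation_lt_one _ (ha i hi))

theorem LiesOver.exists_residue {Q : ValuationSubring E} (hQ : LiesOver φ P Q)
    (hres : ∀ x ∈ P, ∃ a : k, P.valuation (x - algebraMap k F a) < 1) {x : E}
    (hx : Q.valuation x ≤ 1) : ∃ c : Ω, Q.valuation (x - algebraMap Ω E c) < 1 := by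
  rcases eq_or_ne x 0 with rfl | hx0
  · exact ⟨0, by simp⟩
  obtain ⟨x₀, hx₀, c, hc, h⟩ := exists_valuation_sub_lt_one φ hres hx0
  replace h := h Q hQ
  set j := constantExtensionMap φ
  have hj : j x₀ ≠ 0 := (map_ne_zero j).2 hx₀
  have hu : Q.valuation (x / j x₀) = 1 := by
    rw [← hQ.containsConstants.valuation_algebraMap hc]
    refine Valuation.map_eq_of_sub_lt _ ?_
    rwa [hQ.containsConstants.valuation_algebraMap hc]
  have hxj : Q.valuation (j x₀) ≤ 1 := by
    rw [map_div₀, div_eq_one_iff_eq ((Valuation.ne_zero_iff _).2 hj)] at hu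
    rwa [← hu]
  obtain ⟨a, ha⟩ := hres x₀ ((hQ.mem_iff x₀).1 ((Q.valuation_le_one_iff _).1 hxj))
  refine ⟨algebraMap k Ω a * c, ?_⟩
  have h1 : x - algebraMap Ω E (algebraMap k Ω a * c) =
      j x₀ * (x / j x₀ - algebraMap Ω E c) + algebraMap Ω E c * j (x₀ - algebraMap k F a) := by
    rw [map_sub, constantExtensionMap_algebraMap, map_mul]
    field_simp
    ring
  rw [h1]
  exact Valuation.map_add_lt _ (Q.valuation_mul_lt_one hxj h)
    (Q.valuation_mul_lt_one (hQ.containsConstants.valuation_algebraMap_le c)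
      (hQ.valuation_lt_one _ ha))

variable (φ) in
/-- Automorphisms of `E` fixing `F` and preserving the constants. -/
structure IsSemilinear (τ : E ≃+* E) : Prop where
  apply_map : ∀ x, τ (constantExtensionMap φ x) = constantExtensionMap φ x
  exists_apply_algebraMap : ∀ a : Ω, ∃ b : Ω, τ (algebraMap Ω E a) = algebraMap Ω E b
  exists_symm_apply_algebraMap : ∀ a : Ω, ∃ b : Ω, τ.symm (algebraMap Ω E a) = algebraMap Ω E b

theorem IsSemilinear.symm {τ : E ≃+* E} (hτ : IsSemilinear φ τ) : IsSemilinear φ τ.symm :=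
  ⟨fun x => by rw [RingEquiv.symm_apply_eq, hτ.apply_map], hτ.3, hτ.2⟩

theorem LiesOver.valuation_apply {Q : ValuationSubring E} (hQ : LiesOver φ P Q)
    (hres : ∀ x ∈ P, ∃ a : k, P.valuation (x - algebraMap k F a) < 1) {τ : E ≃+* E}
    (hτ : IsSemilinear φ τ) (x : E) : Q.valuation (τ x) = Q.valuation x := by
  rcases eq_or_ne x 0 with rfl | hx0
  · simp
  set j := constantExtensionMap φ
  have hmem : ∀ y, y ∈ Q.comap (τ : E →+* E) ↔ τ y ∈ Q := fun y => Iff.rfl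
  have hQ' : LiesOver φ P (Q.comap (τ : E →+* E)) := by
    refine ⟨fun a => ?_, fun y hy => ?_, fun y hy => ?_⟩
    · obtain ⟨b, hb⟩ := hτ.exists_apply_algebraMap a
      rw [hmem, hb]
      exact hQ.containsConstants b
    · rw [hmem, hτ.apply_map]
      exact hQ.mem y hy
    · by_contra hlt
      have hlt' := not_lt.1 hlt
      rw [not_lt, ← inv_le_one₀ (lt_of_lt_of_le zero_lt_one hlt'), ← map_inv₀,
        ValuationSubring.valuation_le_one_iff, hmem, map_inv₀, hτ.apply_map,
        ← ValuationSubring.valuation_le_one_iff] at hlt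
      have h1 := hQ.valuation_lt_one y hy
      rcases eq_or_ne y 0 with rfl | hy0
      · simp at hlt'
      · have h2 := Q.valuation_mul_lt_one hlt h1
        rw [inv_mul_cancel₀ ((map_ne_zero j).2 hy0), map_one] at h2
        exact lt_irrefl _ h2
  obtain ⟨x₀, hx₀, c, hc, h⟩ := exists_valuation_sub_lt_one φ hres hx0
  have hj : j x₀ ≠ 0 := (map_ne_zero j).2 hx₀
  have hu : ∀ R, LiesOver φ P R → R.valuation (x / j x₀) = 1 := fun R hR => by
    rw [← hR.containsConstants.valuation_algebraMap hc]
    refine Valuation.map_eq_of_sub_lt _ ?_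
    rw [hR.containsConstants.valuation_algebraMap hc]
    exact h R hR
  have h1 := hu _ hQ
  have h2 := hu _ hQ'
  have h3 : Q.valuation (τ (x / j x₀)) ≤ 1 := by
    rw [ValuationSubring.valuation_le_one_iff, ← hmem, ← ValuationSubring.valuation_le_one_iff]
    exact h2.le
  have h4 : Q.valuation (τ (x / j x₀))⁻¹ ≤ 1 := by
    rw [ValuationSubring.valuation_le_one_iff, ← map_inv₀, ← hmem,
      ← ValuationSubring.valuation_le_one_iff, map_inv₀, h2, inv_one]
  have hxj : x / j x₀ ≠ 0 := div_ne_zero hx0 hj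
  have h5 : Q.valuation (τ (x / j x₀)) = 1 := by
    refine le_antisymm h3 ?_
    rw [map_inv₀] at h4
    exact (inv_le_one₀ (zero_lt_iff.2 ((Valuation.ne_zero_iff _).2
      ((map_ne_zero τ).2 hxj)))).1 h4
  rw [map_div₀, hτ.apply_map, map_div₀, ← h1, map_div₀] at h5
  exact (div_left_inj' ((Valuation.ne_zero_iff _).2 hj)).1 h5

end

section

open scoped TensorProduct

variable {k F Ω E : Type*} [Field k] [Field F] [Algebra k F] [Field Ω] [Algebra k Ω] [Field E]
  [Algebra Ω E] (φ : Ω ⊗[k] F ≃ₐ[Ω] E)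

theorem repr_galois_apply {ι : Type*} (B : Module.Basis ι k F) {σ : Ω ≃ₐ[k] Ω} {τ : E ≃+* E}
    (hσ : ∀ a, τ (algebraMap Ω E a) = algebraMap Ω E (σ a))
    (hτ : ∀ x, τ (constantExtensionMap φ x) = constantExtensionMap φ x) (w : E) (i : ι) :
    (constantExtensionBasis φ B).repr (τ w) i = σ ((constantExtensionBasis φ B).repr w i) := by
  set β := constantExtensionBasis φ B with hβ
  have h1 : τ w = Finsupp.linearCombination Ω β ((β.repr w).mapRange σ (map_zero σ)) := by
    conv_lhs => rw [← β.linearCombination_repr w]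
    rw [Finsupp.linearCombination_apply, Finsupp.linearCombination_apply,
      Finsupp.sum_mapRange_index (by simp), Finsupp.sum, Finsupp.sum, map_sum]
    refine Finset.sum_congr rfl fun i _ => ?_
    rw [Algebra.smul_def, Algebra.smul_def, map_mul, hσ, hβ, constantExtensionBasis_apply, hτ]
  rw [h1, Module.Basis.repr_linearCombination, Finsupp.mapRange_apply]

/-- Galois descent: a Galois stable `Ω`-subspace of `E = Ω ⊗ F` is spanned by elements of `F`. -/
theorem le_span_of_galois_stable [IsGalois k Ω] {W : Submodule Ω E}
    (hW : ∀ τ, IsSemilinear φ τ → ∀ w ∈ W, τ w ∈ W) :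
    W ≤ Submodule.span Ω (constantExtensionMap φ '' {x | constantExtensionMap φ x ∈ W}) := by
  classical
  let B := Module.Basis.ofVectorSpace k F
  set β := constantExtensionBasis φ B with hβ
  intro w hw
  induction h : (β.repr w).support using Finset.strongInduction generalizing w with
  | H s ih =>
  have hsub : ∀ w' ∈ W, (β.repr w').support ⊂ s →
      w' ∈ Submodule.span Ω (constantExtensionMap φ '' {x | constantExtensionMap φ x ∈ W}) :=
    fun w' hw' hs => ih _ hs hw' rfl
  rcases eq_or_ne w 0 with rfl | hw0
  · exact zero_mem _
  by_cases hmin : ∃ w' ∈ W, w' ≠ 0 ∧ (β.repr w').support ⊂ s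
  · obtain ⟨w', hw', hw'0, hs⟩ := hmin
    obtain ⟨i, hi⟩ : (β.repr w').support.Nonempty := by
      rw [Finsupp.support_nonempty_iff]
      simpa using hw'0
    have hi' := Finsupp.mem_support_iff.1 hi
    have h1 := hsub w' hw' hs
    have h2 : w - (β.repr w i / β.repr w' i) • w' ∈ W := sub_mem hw (W.smul_mem _ hw')
    have h3 := hsub _ h2 (by
      rw [Finset.ssubset_iff_of_subset]
      · refine ⟨i, hs.1 hi, ?_⟩
        simp [hi']
      · intro l hl
        by_contra hls
        have h4 : β.repr w l = 0 := by
          rw [← Finsupp.notMem_support_iff, h]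
          exact hls
        have h5 : β.repr w' l = 0 := by
          rw [← Finsupp.notMem_support_iff]
          exact fun h => hls (hs.1 h)
        simp [h4, h5] at hl)
    have h4 := add_mem h3 (Submodule.smul_mem _ (β.repr w i / β.repr w' i) h1)
    simpa using h4
  · push Not at hmin
    obtain ⟨i, hi⟩ : (β.repr w).support.Nonempty := by
      rw [Finsupp.support_nonempty_iff]
      simpa using hw0
    have hi' := Finsupp.mem_support_iff.1 hi
    set w₁ := (β.repr w i)⁻¹ • w with hw₁
    have hw₁W : w₁ ∈ W := W.smul_mem _ hw
    have hfix : ∀ σ : Ω ≃ₐ[k] Ω, ∀ l, σ (β.repr w₁ l) = β.repr w₁ l := by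
      intro σ
      obtain ⟨τ, hτσ, hτ⟩ := exists_galois_action φ σ
      have hsl : IsSemilinear φ τ := ⟨hτ, fun a => ⟨_, hτσ a⟩, fun a => ⟨σ.symm a, by
        rw [RingEquiv.symm_apply_eq, hτσ, σ.apply_symm_apply]⟩⟩
      have h1 : τ w₁ - w₁ ∈ W := sub_mem (hW τ hsl _ hw₁W) hw₁W
      have hco : ∀ l, β.repr (τ w₁ - w₁) l = σ (β.repr w₁ l) - β.repr w₁ l := fun l => by
        rw [map_sub, Finsupp.sub_apply, repr_galois_apply φ B hτσ hτ]
      have h2 : τ w₁ - w₁ = 0 := by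
        by_contra h0
        refine hmin _ h1 h0 ?_
        rw [Finset.ssubset_iff_of_subset]
        · refine ⟨i, h ▸ hi, ?_⟩
          rw [Finsupp.notMem_support_iff, hco]
          simp [hw₁, hi']
        · intro l hl
          by_contra hls
          have h4 : β.repr w l = 0 := by
            rw [← Finsupp.notMem_support_iff, h]
            exact hls
          rw [Finsupp.mem_support_iff, hco] at hl
          simp [hw₁, h4] at hl
      intro l
      have h3 := hco l
      rw [h2, map_zero, Finsupp.zero_apply] at h3
      exact (sub_eq_zero.1 h3.symm)
    have hmem : ∀ l, ∃ a : k, algebraMap k Ω a = β.repr w₁ l := by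
      intro l
      have h1 : β.repr w₁ l ∈ fixedField (⊤ : Subgroup (Ω ≃ₐ[k] Ω)) := fun σ => hfix σ.1 l
      rw [InfiniteGalois.fixedField_bot] at h1
      exact h1
    choose a ha using hmem
    have hx : constantExtensionMap φ (∑ l ∈ (β.repr w₁).support, a l • B l) = w₁ := by
      conv_rhs => rw [← β.linearCombination_repr w₁, Finsupp.linearCombination_apply, Finsupp.sum]
      rw [map_sum]
      refine Finset.sum_congr rfl fun l _ => ?_
      rw [Algebra.smul_def, map_mul, constantExtensionMap_algebraMap, ha, Algebra.smul_def, hβ,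
        constantExtensionBasis_apply]
    have hwe : w = β.repr w i • w₁ := by rw [hw₁, smul_inv_smul₀ hi']
    rw [hwe]
    refine Submodule.smul_mem _ _ (Submodule.subset_span ⟨_, ?_, hx⟩)
    change constantExtensionMap φ _ ∈ W
    rwa [hx]

end

section

open scoped TensorProduct

variable {k F Ω E : Type*} [Field k] [Field F] [Algebra k F] [Field Ω] [Algebra k Ω] [Field E]
  [Algebra Ω E] {φ : Ω ⊗[k] F ≃ₐ[Ω] E}

theorem IsSemilinear.refl : IsSemilinear φ (RingEquiv.refl E) :=
  ⟨fun _ => rfl, fun a => ⟨a, rfl⟩, fun a => ⟨a, rfl⟩⟩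

theorem IsSemilinear.trans {τ τ' : E ≃+* E} (hτ : IsSemilinear φ τ) (hτ' : IsSemilinear φ τ') :
    IsSemilinear φ (τ.trans τ') := by
  refine ⟨fun x => ?_, fun a => ?_, fun a => ?_⟩
  · rw [RingEquiv.trans_apply, hτ.apply_map, hτ'.apply_map]
  · obtain ⟨b, hb⟩ := hτ.exists_apply_algebraMap a
    rw [RingEquiv.trans_apply, hb]
    exact hτ'.exists_apply_algebraMap b
  · obtain ⟨b, hb⟩ := hτ'.exists_symm_apply_algebraMap a
    rw [RingEquiv.symm_trans_apply, hb]
    exact hτ.exists_symm_apply_algebraMap b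

theorem IsSemilinear.transcendental [IsAlgClosed Ω] {τ : E ≃+* E} (hτ : IsSemilinear φ τ) {f : E}
    (hf : Transcendental Ω f) : Transcendental Ω (τ f) := by
  intro h
  have h1 : IsIntegral Ω (τ f) := h.isIntegral
  obtain ⟨c, hc⟩ := minpoly.mem_range_of_degree_eq_one Ω (τ f)
      (IsAlgClosed.degree_eq_one_of_irreducible Ω (minpoly.irreducible h1))
  obtain ⟨b, hb⟩ := hτ.exists_symm_apply_algebraMap c
  rw [hc, RingEquiv.symm_apply_apply] at hb
  exact hf (hb ▸ isAlgebraic_algebraMap b)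

theorem IsSemilinear.linearIndependent {τ : E ≃+* E} (hτ : IsSemilinear φ τ) {ι : Type*} {v : ι → E}
    (hv : LinearIndependent Ω v) : LinearIndependent Ω (τ ∘ v) := by
  choose i hi using hτ.exists_symm_apply_algebraMap
  refine hv.map_of_injective_injective i (τ : E →+* E).toAddMonoidHom (fun r hr => ?_)
    (fun m hm => ?_) fun r m => ?_
  · have h1 := hi r
    rw [hr, map_zero] at h1
    exact (map_eq_zero (algebraMap Ω E)).1 ((map_eq_zero τ.symm).1 h1)
  · exact (map_eq_zero τ).1 hm
  · change τ (i r • m) = r • τ m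
    rw [Algebra.smul_def, Algebra.smul_def, map_mul, ← hi, RingEquiv.apply_symm_apply]

theorem IsSemilinear.finrank_adjoin_le [IsAlgClosed Ω] {τ : E ≃+* E} (hτ : IsSemilinear φ τ) {f : E}
    (hf : Transcendental Ω f) [FiniteDimensional Ω⟮f⟯ E] :
    Module.finrank Ω⟮f⟯ E ≤ Module.finrank Ω⟮τ f⟯ E := by
  have : FiniteDimensional Ω⟮(τ : E →+* E) f⟯ E :=
    finiteDimensional_adjoin_of_transcendental (x := f) (hτ.transcendental hf)
  exact finrank_adjoin_le_of_linearIndependent (τ : E →+* E) hf (hτ.transcendental hf)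
    fun n v hv => hτ.linearIndependent hv

theorem IsSemilinear.finrank_adjoin_eq [IsAlgClosed Ω] {τ : E ≃+* E} (hτ : IsSemilinear φ τ) {f : E}
    (hf : Transcendental Ω f) [FiniteDimensional Ω⟮f⟯ E] :
    Module.finrank Ω⟮τ f⟯ E = Module.finrank Ω⟮f⟯ E := by
  have : FiniteDimensional Ω⟮τ f⟯ E :=
    finiteDimensional_adjoin_of_transcendental (x := f) (hτ.transcendental hf)
  refine le_antisymm ?_ (hτ.finrank_adjoin_le hf)
  have h : ∀ f', τ.symm (τ f) = f' → Module.finrank Ω⟮τ f⟯ E ≤ Module.finrank Ω⟮f'⟯ E := by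
    rintro _ rfl
    exact hτ.symm.finrank_adjoin_le (hτ.transcendental hf)
  exact h f (τ.symm_apply_apply f)

variable (φ) in
/-- The orbit of `f` under the semilinear automorphisms. -/
def semilinearOrbit (f : E) : Set E := {y | ∃ τ, IsSemilinear φ τ ∧ τ f = y}

theorem IsSemilinear.apply_mem_adjoin {τ : E ≃+* E} (hτ : IsSemilinear φ τ) {f x : E}
    (hx : x ∈ adjoin Ω (semilinearOrbit φ f)) : τ x ∈ adjoin Ω (semilinearOrbit φ f) := by
  induction hx using adjoin_induction with
  | mem y hy =>
    obtain ⟨τ', hτ', rfl⟩ := hy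
    exact subset_adjoin Ω _ ⟨τ'.trans τ, hτ'.trans hτ, rfl⟩
  | algebraMap a =>
    obtain ⟨b, hb⟩ := hτ.exists_apply_algebraMap a
    rw [hb]
    exact IntermediateField.algebraMap_mem _ b
  | add x y _ _ hx hy => rw [map_add]; exact add_mem hx hy
  | inv x _ hx => rw [map_inv₀]; exact inv_mem hx
  | mul x y _ _ hx hy => rw [map_mul]; exact mul_mem hx hy

theorem ValuationSubring.valuation_comap_le_iff {K L : Type*} [Field K] [Field L] (i : K →+* L)
    (Q : ValuationSubring L) (x y : K) :
    (Q.comap i).valuation x ≤ (Q.comap i).valuation y ↔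
      Q.valuation (i x) ≤ Q.valuation (i y) := by
  rcases eq_or_ne y 0 with rfl | hy
  · simp
  · rw [← div_le_one₀ (zero_lt_iff.2 ((Valuation.ne_zero_iff _).2 hy)), ← map_div₀,
      ValuationSubring.valuation_le_one_iff, ValuationSubring.mem_comap, map_div₀,
      ← ValuationSubring.valuation_le_one_iff, map_div₀,
      div_le_one₀ (zero_lt_iff.2 ((Valuation.ne_zero_iff _).2 ((map_ne_zero i).2 hy)))]

theorem adjoin_preimage_coe_eq_top {L K : Type*} [Field L] [Field K] [Algebra L K] (S : Set K) :
    adjoin L ((↑) ⁻¹' S : Set (adjoin L S)) = ⊤ := by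
  have h := IntermediateField.lift_adjoin L (adjoin L S) ((↑) ⁻¹' S : Set (adjoin L S))
  rw [Set.image_preimage_eq_of_subset fun x hx => ⟨⟨x, subset_adjoin L S hx⟩, rfl⟩] at h
  apply IntermediateField.lift_injective
  rw [h, IntermediateField.lift_top]


/-- The function field `F` contains a function of degree at most the square of the degree of a
given function on a constant field extension. -/
theorem exists_transcendental_finrank_le_sq [IsAlgClosed Ω] [IsGalois k Ω]
    (φ : Ω ⊗[k] F ≃ₐ[Ω] E) {P : ValuationSubring F} (hk : ∀ a, algebraMap k F a ∈ P)
    (hres : ∀ x ∈ P, ∃ a : k, P.valuation (x - algebraMap k F a) < 1) {f : E}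
    (hf : Transcendental Ω f) [FiniteDimensional Ω⟮f⟯ E] :
    ∃ g : F, Transcendental k g ∧ Module.finrank k⟮g⟯ F ≤ Module.finrank Ω⟮f⟯ E ^ 2 := by
  classical
  obtain ⟨Q, hQ⟩ := exists_liesOver φ hk
  set S := semilinearOrbit φ f with hS
  set K := adjoin Ω S with hK
  have hfS : f ∈ S := ⟨_, IsSemilinear.refl, rfl⟩
  let f₀ : K := ⟨f, subset_adjoin Ω S hfS⟩
  have htK : ∀ {x : K}, Transcendental Ω (x : E) → Transcendental Ω x := fun hx h =>
    hx ((isAlgebraic_algHom_iff K.val K.val.injective).2 h)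
  have hKt : ∀ {x : K}, Transcendental Ω x → Transcendental Ω (x : E) := fun hx h =>
    hx ((isAlgebraic_algHom_iff K.val K.val.injective).1 h)
  have hpos : 0 < Module.finrank Ω⟮f⟯ E := Module.finrank_pos
  have hmul := finrank_adjoin_coe_mul_finrank K f₀
  change _ = Module.finrank Ω⟮f⟯ E at hmul
  have hmpos : 0 < Module.finrank K E := by
    rw [← hmul] at hpos
    exact Nat.pos_of_mul_pos_left hpos
  have hfin₀ : FiniteDimensional Ω⟮f₀⟯ K := by
    refine Module.finite_of_finrank_pos ?_
    rw [← hmul] at hpos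
    exact Nat.pos_of_mul_pos_right hpos
  let P' : ValuationSubring K := Q.comap K.val.toRingHom
  have hP' : ContainsConstants Ω P' := fun c => hQ.containsConstants c
  have hle : ∀ x y : K, P'.valuation x ≤ P'.valuation y ↔ Q.valuation (x : E) ≤ Q.valuation (y : E) :=
    fun x y => ValuationSubring.valuation_comap_le_iff _ Q x y
  have hlt : ∀ x y : K, P'.valuation x < P'.valuation y ↔ Q.valuation (x : E) < Q.valuation (y : E) :=
    fun x y => by rw [← not_le, ← not_le, hle]
  have hres' : ∀ x : K, P'.valuation x ≤ 1 → ∃ c : Ω, P'.valuation (x - algebraMap Ω K c) < 1 := by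
    intro x hx
    rw [← map_one P'.valuation, hle] at hx
    obtain ⟨c, hc⟩ := hQ.exists_residue hres (x := (x : E)) (by simpa using hx)
    refine ⟨c, ?_⟩
    rw [← map_one P'.valuation, hlt]
    simpa using hc
  obtain ⟨γ, -, ⟨h, hht, hh, hhP⟩, hdeg⟩ := exists_singlePole_degree_le hP' hres'
    (adjoin_preimage_coe_eq_top (L := Ω) S) ⟨f₀, hfS⟩ (d := Module.finrank Ω⟮f₀⟯ K) (by
      rintro s ⟨τ, hτ, hs⟩
      have hst : Transcendental Ω s := htK (hs ▸ hτ.transcendental hf)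
      refine ⟨hst, finiteDimensional_adjoin_of_transcendental (x := f₀) hst, ?_⟩
      refine Nat.eq_of_mul_eq_mul_right hmpos ?_
      rw [hmul, finrank_adjoin_coe_mul_finrank, ← hτ.finrank_adjoin_eq hf, hs])
  let β : ∀ R : ValuationSubring K, R.ValueGroup := fun R => if R = P' then R.valuation γ else 1
  have hβ : ∀ x : K, x ∈ boundSpace Ω β ↔ (∀ R : ValuationSubring K, ContainsConstants Ω R →
      R ≠ P' → R.valuation x ≤ 1) ∧ P'.valuation x ≤ P'.valuation γ := by
    intro x
    rw [mem_boundSpace]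
    constructor
    · refine fun hx => ⟨fun R hR hRP => ?_, ?_⟩
      · simpa [β, hRP] using hx R hR
      · simpa [β] using hx P' hP'
    · rintro ⟨h1, h2⟩ R hR
      rcases eq_or_ne R P' with rfl | hRP
      · simpa [β] using h2
      · simpa [β, hRP] using h1 R hR hRP
  let W : Submodule Ω E := (boundSpace Ω β).map K.val.toLinearMap
  have hW : ∀ τ, IsSemilinear φ τ → ∀ w ∈ W, τ w ∈ W := by
    rintro τ hτ _ ⟨x, hx, rfl⟩
    let τK : K →+* K := (((τ : E →+* E).comp K.val.toRingHom).codRestrict K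
      fun x => hτ.apply_mem_adjoin x.2)
    refine ⟨τK x, ?_, rfl⟩
    obtain ⟨h1, h2⟩ := (hβ x).1 hx
    refine (hβ _).2 ⟨fun R hR hRP => ?_, ?_⟩
    · rw [ValuationSubring.valuation_le_one_iff]
      change x ∈ R.comap τK
      rw [← ValuationSubring.valuation_le_one_iff]
      refine h1 _ (fun c => ?_) fun hRP' => hRP ?_
      · obtain ⟨b, hb⟩ := hτ.exists_apply_algebraMap c
        have h3 : τK (algebraMap Ω K c) = algebraMap Ω K b := Subtype.ext hb
        change τK (algebraMap Ω K c) ∈ R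
        rw [h3]
        exact hR b
      · ext y
        let z : K := ⟨τ.symm y, hτ.symm.apply_mem_adjoin y.2⟩
        have hz : τK z = y := Subtype.ext (τ.apply_symm_apply y)
        rw [← hz]
        change z ∈ R.comap τK ↔ τ (z : E) ∈ Q
        rw [hRP', ← Q.valuation_le_one_iff, hQ.valuation_apply hres hτ, Q.valuation_le_one_iff]
        rfl
    · rw [hle] at h2 ⊢
      exact (hQ.valuation_apply hres hτ (x : E)).trans_le h2
  have hspan := le_span_of_galois_stable φ hW
  obtain ⟨g, hgW, hg⟩ : ∃ g : F, constantExtensionMap φ g ∈ W ∧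
      Transcendental Ω (constantExtensionMap φ g) := by
    by_contra! hcon
    have h1 : Submodule.span Ω (constantExtensionMap φ '' {x | constantExtensionMap φ x ∈ W}) ≤
        Subalgebra.toSubmodule (algebraicClosure Ω E).toSubalgebra := by
      rw [Submodule.span_le]
      rintro _ ⟨x, hx, rfl⟩
      exact mem_algebraicClosure_iff.2 (not_not.1 (hcon x hx))
    exact hKt hht (mem_algebraicClosure_iff.1 (h1 (hspan ⟨h, (hβ h).2 ⟨hh, hhP⟩, rfl⟩)))
  obtain ⟨y, hy, hyg⟩ := hgW
  change (y : E) = _ at hyg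
  have hyt : Transcendental Ω y := htK (hyg ▸ hg)
  obtain ⟨hyfin, hyd⟩ := hdeg y hyt ((hβ y).1 hy).1 ((hβ y).1 hy).2
  have hfin : FiniteDimensional Ω⟮constantExtensionMap φ g⟯ E :=
    finiteDimensional_adjoin_of_transcendental (x := f) hg
  have hgk : Transcendental k g := by
    intro hga
    obtain ⟨p, hp0, hp⟩ := hga
    refine hg ⟨p.map (algebraMap k Ω), (Polynomial.map_ne_zero_iff (algebraMap k Ω).injective).2 hp0,
      ?_⟩
    rw [aeval_def, eval₂_map]
    have h1 := congrArg (constantExtensionMap φ) hp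
    rw [aeval_def, hom_eval₂, map_zero] at h1
    rw [← h1]
    congr 1
    ext a
    exact (constantExtensionMap_algebraMap φ a).symm
  refine ⟨g, hgk, ?_⟩
  calc Module.finrank k⟮g⟯ F ≤ Module.finrank Ω⟮constantExtensionMap φ g⟯ E :=
        finrank_adjoin_le_of_linearIndependent _ hgk hg
          fun n v hv => linearIndependent_constantExtensionMap φ hv
    _ = Module.finrank Ω⟮y⟯ K * Module.finrank K E := by
        rw [finrank_adjoin_coe_mul_finrank, hyg]
    _ ≤ Module.finrank Ω⟮f₀⟯ K ^ 2 * Module.finrank K E := Nat.mul_le_mul_right _ hyd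
    _ ≤ Module.finrank Ω⟮f₀⟯ K ^ 2 * Module.finrank K E ^ 2 :=
        Nat.mul_le_mul_left _ (Nat.le_self_pow two_ne_zero _)
    _ = Module.finrank Ω⟮f⟯ E ^ 2 := by rw [← mul_pow, hmul]

end

section

open scoped TensorProduct

theorem FFPlace.exists_valuation_sub_lt_one_of_degree_eq_one {k F : Type*} [Field k] [Field F]
    [Algebra k F] {P : FFPlace k F} (hP : P.degree = 1) {x : F} (hx : x ∈ P.asSubring) :
    ∃ a : k, P.asSubring.valuation (x - algebraMap k F a) < 1 := by
  let : Algebra k (IsLocalRing.ResidueField P.asSubring) :=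
    ((IsLocalRing.residue (P.asSubring : Type _)).comp
      ((algebraMap k F).codRestrict P.asSubring.toSubring P.algebraMap_mem)).toAlgebra
  have hfin : Module.finrank k (IsLocalRing.ResidueField P.asSubring) = 1 := hP
  obtain ⟨a, ha⟩ := (finrank_eq_one_iff_of_nonzero'
    (1 : IsLocalRing.ResidueField P.asSubring) one_ne_zero).mp hfin
      (IsLocalRing.residue P.asSubring ⟨x, hx⟩)
  rw [← Algebra.algebraMap_eq_smul_one] at ha
  let c : P.asSubring := ⟨algebraMap k F a, P.algebraMap_mem a⟩
  have hc : IsLocalRing.residue P.asSubring (⟨x, hx⟩ - c) = 0 := by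
    rw [map_sub, sub_eq_zero]
    exact ha.symm
  refine ⟨a, ?_⟩
  rw [IsLocalRing.residue_eq_zero_iff] at hc
  exact (ValuationSubring.valuation_lt_one_iff _ _).mp hc

theorem gonality_le_finrank {k F : Type*} [Field k] [Field F] [Algebra k F] {f : F}
    (hf : Transcendental k f) : gonality k F ≤ Module.finrank k⟮f⟯ F :=
  Nat.sInf_le ⟨f, hf, rfl⟩

theorem IsFunctionField.exists_finrank_eq_gonality {k F : Type*} [Field k] [Field F] [Algebra k F]
    (hF : IsFunctionField k F) :
    ∃ f : F, Transcendental k f ∧ FiniteDimensional k⟮f⟯ F ∧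
      Module.finrank k⟮f⟯ F = gonality k F := by
  obtain ⟨x, hx, _⟩ := hF
  obtain ⟨f, hf, hd⟩ := Nat.sInf_mem
    (s := {d : ℕ | ∃ f : F, Transcendental k f ∧ Module.finrank k⟮f⟯ F = d}) ⟨_, x, hx, rfl⟩
  exact ⟨f, hf, finiteDimensional_adjoin_of_transcendental (x := x) hf, hd⟩

variable {k F L M Ω E : Type*} [Field k] [Field F] [Algebra k F] [Field L] [Algebra k L] [Field M]
  [Algebra L M] [Field Ω] [Algebra k Ω] [Field E] [Algebra Ω E]

theorem IsFunctionField.of_constantExtension [Algebra.IsAlgebraic k L] (φ : L ⊗[k] F ≃ₐ[L] M)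
    (hF : IsFunctionField k F) : IsFunctionField L M := by
  obtain ⟨x, hx, _⟩ := hF
  refine ⟨constantExtensionMap φ x,
    hx.map_of_isAlgebraic (i := algebraMap k L) (constantExtensionMap_algebraMap φ) ?_,
    (finrank_adjoin_le_of_span (i := algebraMap k L) (constantExtensionMap_algebraMap φ)
      (span_range_constantExtensionMap φ) x).1⟩
  intro a
  have h := Algebra.IsAlgebraic.isAlgebraic (R := k) a
  convert h
  exact Algebra.algebra_ext _ _ fun r => rfl

/-- The embedding `L ⊗ F → Ω ⊗ F` induced by an embedding `L → Ω` of constant fields. -/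
def constantExtensionLift (φL : L ⊗[k] F ≃ₐ[L] M) (φ : Ω ⊗[k] F ≃ₐ[Ω] E) (i : L →ₐ[k] Ω) :
    M →+* E :=
  ((φ : Ω ⊗[k] F →+* E).comp
    (Algebra.TensorProduct.map i (AlgHom.id k F) : L ⊗[k] F →ₐ[k] Ω ⊗[k] F).toRingHom).comp
      (φL.symm : M →+* L ⊗[k] F)

theorem constantExtensionLift_algebraMap (φL : L ⊗[k] F ≃ₐ[L] M) (φ : Ω ⊗[k] F ≃ₐ[Ω] E)
    (i : L →ₐ[k] Ω) (a : L) :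
    constantExtensionLift φL φ i (algebraMap L M a) = algebraMap Ω E (i a) := by
  change φ (Algebra.TensorProduct.map i (AlgHom.id k F) (φL.symm (algebraMap L M a))) = _
  rw [φL.symm.commutes, Algebra.TensorProduct.algebraMap_apply, Algebra.algebraMap_self_apply,
    Algebra.TensorProduct.map_tmul, map_one, ← φ.commutes, Algebra.TensorProduct.algebraMap_apply,
    Algebra.algebraMap_self_apply]

theorem span_range_constantExtensionLift (φL : L ⊗[k] F ≃ₐ[L] M) (φ : Ω ⊗[k] F ≃ₐ[Ω] E)
    (i : L →ₐ[k] Ω) :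
    Submodule.span Ω (Set.range (constantExtensionLift φL φ i)) = ⊤ := by
  refine top_unique ((span_range_constantExtensionMap φ).ge.trans (Submodule.span_mono ?_))
  rintro _ ⟨x, rfl⟩
  refine ⟨φL (1 ⊗ₜ x), ?_⟩
  change φ (Algebra.TensorProduct.map i (AlgHom.id k F) (φL.symm (φL (1 ⊗ₜ x)))) = φ (1 ⊗ₜ x)
  rw [AlgEquiv.symm_apply_apply, Algebra.TensorProduct.map_tmul, map_one, AlgHom.id_apply]

theorem gonality_le_sq_gonality [IsAlgClosed Ω] [IsGalois k Ω] [Algebra.IsAlgebraic k L]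
    (φL : L ⊗[k] F ≃ₐ[L] M) (φ : Ω ⊗[k] F ≃ₐ[Ω] E) (hF : IsFunctionField k F)
    {P : FFPlace k F} (hP : P.degree = 1) : gonality k F ≤ gonality L M ^ 2 := by
  obtain ⟨f, hf, _, hd⟩ := (hF.of_constantExtension φL).exists_finrank_eq_gonality
  let i : L →ₐ[k] Ω := IsAlgClosed.lift
  have hi : ∀ a : Ω, letI := i.toRingHom.toAlgebra; IsAlgebraic L a := by
    intro a
    let := i.toRingHom.toAlgebra
    have : IsScalarTower k L Ω := IsScalarTower.of_algebraMap_eq fun r => (i.commutes r).symm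
    exact (Algebra.IsAlgebraic.isAlgebraic (R := k) a).tower_top L
  have hij := constantExtensionLift_algebraMap φL φ i
  obtain ⟨_, hle⟩ := finrank_adjoin_le_of_span (i := i.toRingHom) hij
    (span_range_constantExtensionLift φL φ i) f
  obtain ⟨g, hg, hgle⟩ := exists_transcendental_finrank_le_sq φ P.algebraMap_mem
    (fun x hx => FFPlace.exists_valuation_sub_lt_one_of_degree_eq_one hP hx)
    (hf.map_of_isAlgebraic (i := i.toRingHom) hij hi)
  rw [← hd]
  exact (gonality_le_finrank hg).trans (hgle.trans (Nat.pow_le_pow_left hle 2))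

theorem bijective_algebraMap_fractionRing_tensorProduct (k F L : Type*) [Field k] [Field F]
    [Algebra k F] [Field L] [Algebra k L] [Algebra.IsAlgebraic k L] [IsDomain (L ⊗[k] F)] :
    Function.Bijective (algebraMap (L ⊗[k] F) (FractionRing (L ⊗[k] F))) :=
  (isField_tensorProduct k F L).localization_map_bijective (M := nonZeroDivisors (L ⊗[k] F))
    fun h => nonZeroDivisors.ne_zero h rfl

end

/-- let `X` be a geometrically integral curve over a perfect field `k` with a
`k`-rational point (a place of degree 1), with function field `F = k(X)`, and let `L ⊇ k`
be an algebraic field extension.  Then `γ_L(X) ≥ √(γ_k(X))`, where `γ_L(X)` is the gonality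
of the function field `Frac(L ⊗_k F)` of `X_L` over `L`. -/
theorem sqrt_gonality_le_gonality_baseChange
    (k F L : Type*) [Field k] [Field F] [Algebra k F] [PerfectField k]
    (hF : IsFunctionField k F)
    [IsDomain (TensorProduct k (AlgebraicClosure k) F)]
    [Field L] [Algebra k L] [Algebra.IsAlgebraic k L]
    [IsDomain (TensorProduct k L F)]
    (hP : ∃ P : FFPlace k F, P.degree = 1) :
    letI : Algebra L (FractionRing (TensorProduct k L F)) :=
      ((algebraMap (TensorProduct k L F) (FractionRing (TensorProduct k L F))).comp
        (algebraMap L (TensorProduct k L F))).toAlgebra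
    Real.sqrt (gonality k F) ≤ (gonality L (FractionRing (TensorProduct k L F)) : ℝ) := by
  let : Algebra L (FractionRing (TensorProduct k L F)) :=
    ((algebraMap (TensorProduct k L F) (FractionRing (TensorProduct k L F))).comp
      (algebraMap L (TensorProduct k L F))).toAlgebra
  obtain ⟨P, hP⟩ := hP
  let φL : TensorProduct k L F ≃ₐ[L] FractionRing (TensorProduct k L F) :=
    AlgEquiv.ofBijective
      { algebraMap (TensorProduct k L F) (FractionRing (TensorProduct k L F)) with
        commutes' := fun _ => rfl }
      (bijective_algebraMap_fractionRing_tensorProduct k F L)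
  let φ : TensorProduct k (AlgebraicClosure k) F ≃ₐ[AlgebraicClosure k]
      FractionRing (TensorProduct k (AlgebraicClosure k) F) :=
    AlgEquiv.ofBijective (IsScalarTower.toAlgHom _ _ _)
      (bijective_algebraMap_fractionRing_tensorProduct k F (AlgebraicClosure k))
  rw [Real.sqrt_le_left (Nat.cast_nonneg _)]
  exact_mod_cast gonality_le_sq_gonality φL φ hF hP
end

section
/- Fix a prime p and let S = S_p × S_{≠p} where S_p = Z_p^× and S_{≠p} = ∏_{ℓ prime, ℓ ≠ p} SL_2(Z_ℓ). For each real number B > 0, there are at most finitely many open subgroups G of S such that the image G_p of G in S_p has index (S_p : G_p) < B and the image G_{≠p} of G in S_{≠p} has index (S_{≠p} : G_{≠p}) < B. -/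
/-- `SL₂(ℤ_ℓ)` for a prime `ℓ` (with the primality hypothesis carried explicitly). -/
def SL2Zl (ℓ : ℕ) (hℓ : ℓ.Prime) : Type :=
  haveI : Fact ℓ.Prime := ⟨hℓ⟩
  Matrix.SpecialLinearGroup (Fin 2) ℤ_[ℓ]

noncomputable instance (ℓ : ℕ) (hℓ : ℓ.Prime) : Group (SL2Zl ℓ hℓ) :=
  haveI : Fact ℓ.Prime := ⟨hℓ⟩
  inferInstanceAs (Group (Matrix.SpecialLinearGroup (Fin 2) ℤ_[ℓ]))

/-- The `ℓ`-adic topology on `SL₂(ℤ_ℓ)`, induced from the (product) topology on matrices. -/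
instance (ℓ : ℕ) (hℓ : ℓ.Prime) : TopologicalSpace (SL2Zl ℓ hℓ) :=
  haveI : Fact ℓ.Prime := ⟨hℓ⟩
  inferInstanceAs (TopologicalSpace {A : Matrix (Fin 2) (Fin 2) ℤ_[ℓ] // A.det = 1})

/-- The profinite group `S_{≠p} = ∏_{ℓ prime, ℓ ≠ p} SL₂(ℤ_ℓ)`, with the product topology. -/
def SNe (p : ℕ) : Type :=
  ∀ ℓ : {ℓ : ℕ // ℓ.Prime ∧ ℓ ≠ p}, SL2Zl ℓ.1 ℓ.2.1

noncomputable instance (p : ℕ) : Group (SNe p) :=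
  inferInstanceAs (Group (∀ ℓ : {ℓ : ℕ // ℓ.Prime ∧ ℓ ≠ p}, SL2Zl ℓ.1 ℓ.2.1))

instance (p : ℕ) : TopologicalSpace (SNe p) :=
  inferInstanceAs (TopologicalSpace (∀ ℓ : {ℓ : ℕ // ℓ.Prime ∧ ℓ ≠ p}, SL2Zl ℓ.1 ℓ.2.1))

open scoped MatrixGroups

namespace Matrix.SpecialLinearGroup
variable {R : Type*} [CommRing R]

/-- The upper unitriangular matrix with off-diagonal entry `x`. -/
def upperUnipotent (x : R) : SL(2, R) := ⟨!![1, x; 0, 1], by simp [Matrix.det_fin_two]⟩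

/-- The lower unitriangular matrix with off-diagonal entry `x`. -/
def lowerUnipotent (x : R) : SL(2, R) := ⟨!![1, 0; x, 1], by simp [Matrix.det_fin_two]⟩

/-- The diagonal matrix with entries `u` and `u⁻¹`. -/
def diagUnit (u : Rˣ) : SL(2, R) :=
  ⟨!![(u : R), 0; 0, ((u⁻¹ : Rˣ) : R)], by simp [Matrix.det_fin_two]⟩

theorem coe_upperUnipotent (x : R) :
    (upperUnipotent x : Matrix (Fin 2) (Fin 2) R) = !![1, x; 0, 1] :=
  rfl

theorem coe_lowerUnipotent (x : R) :
    (lowerUnipotent x : Matrix (Fin 2) (Fin 2) R) = !![1, 0; x, 1] :=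
  rfl

theorem coe_diagUnit (u : Rˣ) :
    (diagUnit u : Matrix (Fin 2) (Fin 2) R) = !![(u : R), 0; 0, ((u⁻¹ : Rˣ) : R)] :=
  rfl

theorem upperUnipotent_zero : upperUnipotent (0 : R) = 1 := by
  exact Subtype.ext (by simp [coe_upperUnipotent, Matrix.one_fin_two])

theorem lowerUnipotent_zero : lowerUnipotent (0 : R) = 1 := by
  exact Subtype.ext (by simp [coe_lowerUnipotent, Matrix.one_fin_two])

theorem upperUnipotent_mul (x y : R) :
    upperUnipotent x * upperUnipotent y = upperUnipotent (x + y) := by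
  exact Subtype.ext (by simp [coe_mul, coe_upperUnipotent, add_comm])

theorem lowerUnipotent_mul (x y : R) :
    lowerUnipotent x * lowerUnipotent y = lowerUnipotent (x + y) := by
  exact Subtype.ext (by simp [coe_mul, coe_lowerUnipotent])

theorem upperUnipotent_pow (x : R) (n : ℕ) :
    upperUnipotent x ^ n = upperUnipotent (n * x) := by
  induction n with
  | zero => simp [upperUnipotent_zero]
  | succ n ih => rw [pow_succ, ih, upperUnipotent_mul]; congr 1; push_cast; ring

theorem lowerUnipotent_pow (x : R) (n : ℕ) :
    lowerUnipotent x ^ n = lowerUnipotent (n * x) := by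
  induction n with
  | zero => simp [lowerUnipotent_zero]
  | succ n ih => rw [pow_succ, ih, lowerUnipotent_mul]; congr 1; push_cast; ring

theorem diagUnit_mul (u v : Rˣ) : diagUnit u * diagUnit v = diagUnit (u * v) := by
  exact Subtype.ext (by simp [coe_mul, coe_diagUnit, mul_comm])

theorem diagUnit_one : diagUnit (1 : Rˣ) = 1 := by
  exact Subtype.ext (by simp [coe_diagUnit, Matrix.one_fin_two])

theorem diagUnit_pow (u : Rˣ) (n : ℕ) : diagUnit u ^ n = diagUnit (u ^ n) := by
  induction n with
  | zero => simp [diagUnit_one]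
  | succ n ih => rw [pow_succ, ih, diagUnit_mul, pow_succ]

theorem diagUnit_mul_upperUnipotent (u : Rˣ) (x : R) :
    diagUnit u * upperUnipotent x = upperUnipotent ((u : R) ^ 2 * x) * diagUnit u := by
  refine Subtype.ext ?_
  simp [coe_mul, coe_diagUnit, coe_upperUnipotent]
  linear_combination (-(u : R) * x) * u.mul_inv

theorem lowerUnipotent_mul_diagUnit (u : Rˣ) (x : R) :
    lowerUnipotent x * diagUnit u = diagUnit u * lowerUnipotent ((u : R) ^ 2 * x) := by
  refine Subtype.ext ?_
  simp [coe_mul, coe_diagUnit, coe_lowerUnipotent]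
  linear_combination (-(u : R) * x) * u.mul_inv

open scoped commutatorElement in
theorem commutatorElement_diagUnit_upperUnipotent (u : Rˣ) (x : R) :
    ⁅diagUnit u, upperUnipotent x⁆ = upperUnipotent (((u : R) ^ 2 - 1) * x) := by
  rw [commutatorElement_def, diagUnit_mul_upperUnipotent, mul_inv_cancel_right,
    mul_inv_eq_iff_eq_mul, upperUnipotent_mul]
  congr 1; ring

open scoped commutatorElement in
theorem commutatorElement_diagUnit_inv_lowerUnipotent (u : Rˣ) (x : R) :
    ⁅(diagUnit u)⁻¹, lowerUnipotent x⁆ = lowerUnipotent (((u : R) ^ 2 - 1) * x) := by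
  rw [commutatorElement_def, inv_inv, mul_assoc (diagUnit u)⁻¹, lowerUnipotent_mul_diagUnit,
    inv_mul_cancel_left, mul_inv_eq_iff_eq_mul, lowerUnipotent_mul]
  congr 1; ring

/-- Over a local ring, a matrix of determinant one congruent to `1` modulo `c ^ 2` is a product of
five unitriangular matrices whose off-diagonal entries are multiples of `c`. -/
theorem exists_eq_mul_unipotent [IsLocalRing R] (c : R) (A : SL(2, R))
    (hA : ∀ i j, c ^ 2 ∣ A i j - (1 : SL(2, R)) i j) :
    ∃ x₁ x₂ x₃ x₄ x₅ : R, A = upperUnipotent (c * x₁) * lowerUnipotent (c * x₂) *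
      upperUnipotent (c * x₃) * lowerUnipotent (c * x₄) * upperUnipotent (c * x₅) := by
  obtain ⟨a, ha⟩ := hA 0 0
  obtain ⟨b, hb⟩ := hA 0 1
  obtain ⟨d, hd⟩ := hA 1 0
  simp only [coe_one, one_apply_eq, ne_eq, zero_ne_one, one_ne_zero, not_false_eq_true,
    one_apply_ne, sub_zero] at ha hb hd
  have hdet := A.det_coe
  rw [Matrix.det_fin_two] at hdet
  obtain ⟨x, hx⟩ : ∃ x, IsUnit (A 0 0 + c * x * A 1 0) := by
    by_cases h0 : IsUnit (A 0 0)
    · exact ⟨0, by simpa using h0⟩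
    refine ⟨1, ?_⟩
    have hc : IsUnit c := by
      by_contra hc
      refine h0 ?_
      have : A 0 0 + -(c ^ 2 * a) = 1 := by rw [← ha]; ring
      refine (IsLocalRing.isUnit_or_isUnit_of_add_one this).resolve_right fun h => hc ?_
      rw [IsUnit.neg_iff] at h
      exact (isUnit_pow_iff two_ne_zero).mp (isUnit_of_mul_isUnit_left h)
    have hs : A 0 0 * A 1 1 + -(A 0 1 * A 1 0) = 1 := by linear_combination hdet
    have h10 : IsUnit (A 1 0) := by
      have := (IsLocalRing.isUnit_or_isUnit_of_add_one hs).resolve_left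
        fun h => h0 (isUnit_of_mul_isUnit_left h)
      rw [IsUnit.neg_iff] at this
      exact isUnit_of_mul_isUnit_right this
    by_contra hn
    have hu : IsUnit ((A 0 0 + c * 1 * A 1 0) + -A 0 0) := by
      have : (A 0 0 + c * 1 * A 1 0) + -A 0 0 = c * A 1 0 := by ring
      rw [this]; exact hc.mul h10
    rcases IsLocalRing.isUnit_or_isUnit_of_isUnit_add hu with h | h
    · exact hn h
    · exact h0 (by simpa using h)
  obtain ⟨v, hv⟩ := hx
  have hw := v.mul_inv
  set w : R := ((v⁻¹ : Rˣ) : R)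
  refine ⟨-x, (c * d - (a + c * x * d)) * w, 1, a + c * x * d,
    (c * b + x * A 1 1 - 1) * w, ?_⟩
  have hy : (v : R) = 1 + c ^ 2 * (a + c * x * d) := by
    rw [hv, hd]; linear_combination ha
  refine Subtype.ext ?_
  simp only [coe_mul, coe_upperUnipotent, coe_lowerUnipotent]
  refine (Matrix.eta_fin_two (A : Matrix (Fin 2) (Fin 2) R)).trans ?_
  generalize (A : Matrix (Fin 2) (Fin 2) R) 0 0 = α at *
  generalize (A : Matrix (Fin 2) (Fin 2) R) 0 1 = β at *
  generalize (A : Matrix (Fin 2) (Fin 2) R) 1 0 = γ at *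
  generalize (A : Matrix (Fin 2) (Fin 2) R) 1 1 = δ at *
  generalize (v : R) = z at *
  clear_value w
  generalize a + c * x * d = y at *
  obtain ⟨s, hs⟩ : ∃ s, s = (c * d - y) * w := ⟨_, rfl⟩
  obtain ⟨t, ht⟩ : ∃ t, t = (c * b + x * δ - 1) * w := ⟨_, rfl⟩
  have hsz : c * s * z = γ - c * y := by
    rw [hs, hd]; linear_combination c * (c * d - y) * hw
  have htz : c * t * z = β + c * x * δ - c := by
    rw [ht, hb]; linear_combination c * (c * b + x * δ - 1) * hw
  have h11 : γ * (c * t) + c * s * c + 1 = δ := by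
    linear_combination (γ * (c * t) + c * s * c + 1 - δ) * (-hw) +
      w * (γ * htz + c * hsz + hy - δ * hv - hdet)
  have h10 : γ = c * s + (c * s * c + 1) * (c * y) := by
    linear_combination c * s * hy - hsz
  have h00 : α = 1 + -(c * x * (c * s)) + ((1 + -(c * x * (c * s))) * c + -(c * x)) * (c * y) := by
    linear_combination hy - hv - c * x * h10
  have h01 : β = (1 + -(c * x * (c * s)) + ((1 + -(c * x * (c * s))) * c + -(c * x)) * (c * y)) *
      (c * t) + ((1 + -(c * x * (c * s))) * c + -(c * x)) := by
    linear_combination c * t * (h00 + hv) - htz + c * x * h11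
  rw [← hs, ← ht]
  simp only [mul_neg, mul_one, Matrix.mul_fin_two, one_mul, neg_mul, mul_zero, add_zero, zero_add,
    EmbeddingLike.apply_eq_iff_eq, Matrix.vecCons_inj, and_true]
  refine ⟨⟨h00, h01⟩, h10, ?_⟩
  linear_combination c * t * h10 - h11

end Matrix.SpecialLinearGroup

section Padic

variable {ℓ : ℕ} [Fact ℓ.Prime]

theorem PadicInt.isUnit_natCast {n : ℕ} : IsUnit (n : ℤ_[ℓ]) ↔ ℓ.Coprime n := by
  rw [PadicInt.isUnit_iff, PadicInt.norm_natCast_eq_one_iff]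

theorem PadicInt.natCast_dvd_prime_pow {n : ℕ} (hn : n ≠ 0) : (n : ℤ_[ℓ]) ∣ (ℓ : ℤ_[ℓ]) ^ n := by
  have hℓ : ℓ.Prime := Fact.out
  obtain ⟨e, m, hm, he⟩ := Nat.exists_eq_pow_mul_and_not_dvd hn ℓ hℓ.ne_one
  have hle : e ≤ n := by
    have hm0 : 0 < m := Nat.pos_of_ne_zero fun h => hm (h ▸ dvd_zero ℓ)
    calc e ≤ ℓ ^ e := (Nat.lt_pow_self hℓ.one_lt).le
      _ ≤ ℓ ^ e * m := Nat.le_mul_of_pos_right _ hm0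
      _ = n := he.symm
  have hu : IsUnit (m : ℤ_[ℓ]) :=
    PadicInt.isUnit_natCast.mpr ((Nat.Prime.coprime_iff_not_dvd hℓ).mpr hm)
  have hcast : (n : ℤ_[ℓ]) = (ℓ : ℤ_[ℓ]) ^ e * m := by rw [he]; push_cast; rfl
  rw [hcast, hu.mul_right_dvd]
  exact pow_dvd_pow _ hle

/-- A `p`-adic unit sufficiently close to `1` is an `n`-th power. -/
theorem PadicInt.exists_units_pow_eq {n : ℕ} (hn : n ≠ 0) (u : ℤ_[ℓ]ˣ)
    (hu : (ℓ : ℤ_[ℓ]) ^ (2 * n + 1) ∣ (u : ℤ_[ℓ]) - 1) : ∃ v : ℤ_[ℓ]ˣ, v ^ n = u := by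
  have hℓ : ℓ.Prime := Fact.out
  have hnorm : ‖(u : ℤ_[ℓ]) - 1‖ < ‖(n : ℤ_[ℓ])‖ ^ 2 := by
    obtain ⟨k, hk⟩ := PadicInt.natCast_dvd_prime_pow (ℓ := ℓ) hn
    have h1 : ‖(ℓ : ℤ_[ℓ])‖ ^ n ≤ ‖(n : ℤ_[ℓ])‖ := by
      rw [← norm_pow, hk, norm_mul]
      exact mul_le_of_le_one_right (norm_nonneg _) k.norm_le_one
    obtain ⟨m, hm⟩ := hu
    have h0 : 0 < ‖(ℓ : ℤ_[ℓ])‖ := by simp [hℓ.pos]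
    calc ‖(u : ℤ_[ℓ]) - 1‖ ≤ ‖(ℓ : ℤ_[ℓ])‖ ^ (2 * n + 1) := by
          rw [hm, norm_mul, norm_pow]
          exact mul_le_of_le_one_right (by positivity) m.norm_le_one
      _ = (‖(ℓ : ℤ_[ℓ])‖ ^ n) ^ 2 * ‖(ℓ : ℤ_[ℓ])‖ := by ring
      _ < (‖(ℓ : ℤ_[ℓ])‖ ^ n) ^ 2 :=
        mul_lt_of_lt_one_right (by positivity) ((PadicInt.norm_lt_one_iff_dvd _).mpr dvd_rfl)
      _ ≤ ‖(n : ℤ_[ℓ])‖ ^ 2 := by gcongr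
  obtain ⟨z, hz, -⟩ := hensels_lemma (p := ℓ) (R := ℤ_[ℓ])
    (F := Polynomial.X ^ n - Polynomial.C (u : ℤ_[ℓ])) (a := 1)
    (by simpa [norm_sub_rev, Polynomial.derivative_X_pow] using hnorm)
  have hzu : z ^ n = u := by simpa [sub_eq_zero] using hz
  have hz1 : IsUnit z := (isUnit_pow_iff hn).mp (hzu ▸ u.isUnit)
  exact ⟨hz1.unit, Units.ext (by simpa using hzu)⟩

theorem PadicInt.exists_units_pow_dvd {N c : ℕ}
    (hc : ((2 : ℤ) ^ (2 * N) - 1) * (3 ^ (2 * N) - 1) * N = c) :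
    ∃ u : ℤ_[ℓ]ˣ, (((u ^ N : ℤ_[ℓ]ˣ) : ℤ_[ℓ]) ^ 2 - 1) * N ∣ (c : ℤ_[ℓ]) := by
  have hcast : ((2 : ℤ_[ℓ]) ^ (2 * N) - 1) * (3 ^ (2 * N) - 1) * N = c := by
    exact_mod_cast congrArg (Int.cast : ℤ → ℤ_[ℓ]) hc
  rcases eq_or_ne ℓ 2 with rfl | h
  · have h3 : IsUnit ((3 : ℕ) : ℤ_[2]) := PadicInt.isUnit_natCast.mpr (by norm_num)
    refine ⟨h3.unit, 2 ^ (2 * N) - 1, ?_⟩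
    rw [← hcast]; push_cast [IsUnit.unit_spec]; ring
  · have h2 : IsUnit ((2 : ℕ) : ℤ_[ℓ]) :=
      PadicInt.isUnit_natCast.mpr ((Nat.coprime_primes Fact.out Nat.prime_two).mpr h)
    refine ⟨h2.unit, 3 ^ (2 * N) - 1, ?_⟩
    rw [← hcast]; push_cast [IsUnit.unit_spec]; ring

end Padic

section Group

theorem Subgroup.finite_setOf_le {G : Type*} [Group G] (V : Subgroup G) [V.FiniteIndex] :
    {H : Subgroup G | V ≤ H}.Finite := by
  have : Finite (Subgroup (G ⧸ V.normalCore)) := Finite.of_injective _ SetLike.coe_injective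
  have : Finite {H : Subgroup G // V.normalCore ≤ H} :=
    Finite.of_equiv _ (QuotientGroup.comapMk'OrderIso V.normalCore).toEquiv
  have hfin : {H : Subgroup G | V.normalCore ≤ H}.Finite := this
  exact hfin.subset fun H hH => V.normalCore_le.trans hH

theorem Subgroup.pow_factorial_mem_of_index_le {G : Type*} [Group G] {H : Subgroup G} {k : ℕ}
    (h0 : H.index ≠ 0) (hk : H.index ≤ k) (g : G) : g ^ k.factorial ∈ H :=
  Subgroup.pow_mem_of_index_ne_zero_of_dvd h0 g fun _ hm hmi =>
    Nat.dvd_factorial hm (hmi.trans hk)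

open scoped commutatorElement in
theorem Subgroup.commutator_mem_comap_inr {A H : Type*} [CommGroup A] [Group H]
    {G : Subgroup (A × H)} {x y : H} (hx : x ∈ G.map (MonoidHom.snd A H))
    (hy : y ∈ G.map (MonoidHom.snd A H)) : ⁅x, y⁆ ∈ G.comap (MonoidHom.inr A H) := by
  obtain ⟨⟨s, x⟩, hs, rfl⟩ := hx
  obtain ⟨⟨t, y⟩, ht, rfl⟩ := hy
  have h : ⁅(s, x), (t, y)⁆ ∈ G := by
    rw [commutatorElement_def]
    exact G.mul_mem (G.mul_mem (G.mul_mem hs ht) (G.inv_mem hs)) (G.inv_mem ht)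
  have he : ⁅(s, x), (t, y)⁆ = ((1, ⁅x, y⁆) : A × H) :=
    Prod.ext (commutatorElement_eq_one_iff_mul_comm.mpr (mul_comm s t)) rfl
  rw [he] at h
  exact h

end Group

section Product

open Matrix.SpecialLinearGroup
open scoped commutatorElement

/-- If the second projection of `G` contains all `N`-th powers, then `G` contains the congruence
subgroup of level `c ^ 2` of the product of the groups `SL₂(R i)`. -/
theorem mem_comap_inr_of_forall_dvd {A ι : Type*} {R : ι → Type*} [CommGroup A]
    [∀ i, CommRing (R i)] [∀ i, IsLocalRing (R i)] {G : Subgroup (A × ∀ i, SL(2, R i))} {N c : ℕ}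
    (hN : ∀ g : ∀ i, SL(2, R i), g ^ N ∈ G.map (MonoidHom.snd A _))
    (hc : ∀ i, ∃ u : (R i)ˣ, (((u ^ N : (R i)ˣ) : R i) ^ 2 - 1) * N ∣ (c : R i))
    (g : ∀ i, SL(2, R i)) (hg : ∀ i j k, (c : R i) ^ 2 ∣ g i j k - (1 : SL(2, R i)) j k) :
    g ∈ G.comap (MonoidHom.inr A _) := by
  choose u e hu using hc
  have hU (x : ∀ i, R i) :
      (fun i => upperUnipotent ((c : R i) * x i)) ∈ G.comap (MonoidHom.inr A _) := by
    convert Subgroup.commutator_mem_comap_inr (hN fun i => diagUnit (u i))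
      (hN fun i => upperUnipotent (e i * x i)) using 1
    funext i
    change _ = ⁅diagUnit (u i) ^ N, upperUnipotent (e i * x i) ^ N⁆
    rw [diagUnit_pow, upperUnipotent_pow, commutatorElement_diagUnit_upperUnipotent, hu]
    congr 1; ring
  have hL (x : ∀ i, R i) :
      (fun i => lowerUnipotent ((c : R i) * x i)) ∈ G.comap (MonoidHom.inr A _) := by
    convert Subgroup.commutator_mem_comap_inr (hN fun i => (diagUnit (u i))⁻¹)
      (hN fun i => lowerUnipotent (e i * x i)) using 1
    funext i
    change _ = ⁅(diagUnit (u i))⁻¹ ^ N, lowerUnipotent (e i * x i) ^ N⁆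
    rw [inv_pow, diagUnit_pow, lowerUnipotent_pow, commutatorElement_diagUnit_inv_lowerUnipotent,
      hu]
    congr 1; ring
  choose x₁ x₂ x₃ x₄ x₅ hx using fun i => exists_eq_mul_unipotent (c : R i) (g i) (hg i)
  have := mul_mem (mul_mem (mul_mem (mul_mem (hU x₁) (hL x₂)) (hU x₃)) (hL x₄)) (hU x₅)
  convert this using 1
  exact funext hx

/-- The product of the groups `SL₂(ℤ_ℓ)` has a normal subgroup of finite index contained in the
congruence subgroup of level `m`. -/
theorem exists_normal_finiteIndex_forall_dvd {ι : Type*} {q : ι → ℕ} [∀ i, Fact (q i).Prime]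
    (hq : Function.Injective q) {m : ℕ} (hm : m ≠ 0) :
    ∃ V : Subgroup (∀ i, SL(2, ℤ_[q i])), V.Normal ∧ V.FiniteIndex ∧
      ∀ g ∈ V, ∀ i j k, (m : ℤ_[q i]) ∣ g i j k - (1 : SL(2, ℤ_[q i])) j k := by
  have : Finite {i // q i ≤ m} :=
    Finite.of_injective (fun i => (⟨q i, i.2⟩ : Set.Iic m))
      fun a b h => Subtype.ext (hq (congrArg Subtype.val h))
  have (i : ι) : NeZero (q i ^ m) := ⟨pow_ne_zero _ (Fact.out : (q i).Prime).ne_zero⟩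
  let φ : (∀ i, SL(2, ℤ_[q i])) →* ∀ i : {i // q i ≤ m}, SL(2, ZMod (q i ^ m)) :=
    MonoidHom.pi fun i => (Matrix.SpecialLinearGroup.map (PadicInt.toZModPow m)).comp
      (Pi.evalMonoidHom _ i.1)
  have (i : {i // q i ≤ m}) : Finite SL(2, ZMod (q i ^ m)) :=
    Finite.of_injective _ Subtype.val_injective
  refine ⟨φ.ker, inferInstance, inferInstance, fun g hg i j k => ?_⟩
  by_cases hi : q i ≤ m
  · refine (PadicInt.natCast_dvd_prime_pow hm).trans ?_
    rw [← Ideal.mem_span_singleton, ← PadicInt.ker_toZModPow, RingHom.mem_ker, map_sub, sub_eq_zero]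
    have h : Matrix.SpecialLinearGroup.map (PadicInt.toZModPow m) (g i) =
        Matrix.SpecialLinearGroup.map (PadicInt.toZModPow m) 1 := by
      rw [map_one]; exact congrFun hg ⟨i, hi⟩
    exact congrArg (fun B : SL(2, ZMod (q i ^ m)) => B j k) h
  · have hu : IsUnit (m : ℤ_[q i]) := PadicInt.isUnit_natCast.mpr
      ((Nat.Prime.coprime_iff_not_dvd Fact.out).mpr
        fun h => hi (Nat.le_of_dvd (Nat.pos_of_ne_zero hm) h))
    exact hu.dvd

/-- A subgroup of `ℤ_pˣ × ∏ SL₂(ℤ_ℓ)` whose two projections have index at most `n` contains a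
subgroup of finite index depending only on `n`, so there are finitely many such subgroups. -/
theorem finite_subgroups_of_map_index_le (p : ℕ) [Fact p.Prime] {ι : Type*} {q : ι → ℕ}
    [∀ i, Fact (q i).Prime] (hq : Function.Injective q) (n : ℕ) :
    {G : Subgroup (ℤ_[p]ˣ × ∀ i, SL(2, ℤ_[q i])) |
      ((G.map (MonoidHom.fst _ _)).index ≠ 0 ∧ (G.map (MonoidHom.fst _ _)).index ≤ n) ∧
      ((G.map (MonoidHom.snd _ _)).index ≠ 0 ∧ (G.map (MonoidHom.snd _ _)).index ≤ n)}.Finite := by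
  set N := n.factorial
  have hN : N ≠ 0 := n.factorial_ne_zero
  have h2 : 0 < (2 : ℤ) ^ (2 * N) - 1 := sub_pos.mpr (one_lt_pow₀ (by norm_num) (by positivity))
  have h3 : 0 < (3 : ℤ) ^ (2 * N) - 1 := sub_pos.mpr (one_lt_pow₀ (by norm_num) (by positivity))
  obtain ⟨c, hc⟩ := Int.eq_ofNat_of_zero_le
    (a := ((2 : ℤ) ^ (2 * N) - 1) * (3 ^ (2 * N) - 1) * N) (by positivity)
  have hc0 : c ≠ 0 := by
    rintro rfl
    exact (mul_ne_zero (mul_ne_zero h2.ne' h3.ne') (Nat.cast_ne_zero.mpr hN)) hc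
  obtain ⟨V, hVn, hVf, hV⟩ := exists_normal_finiteIndex_forall_dvd hq (pow_ne_zero 2 hc0)
  set M := N * V.index
  have hM : M ≠ 0 := mul_ne_zero hN hVf.index_ne_zero
  have : NeZero (p ^ (2 * M + 1)) := ⟨pow_ne_zero _ (Fact.out : p.Prime).ne_zero⟩
  let W : Subgroup ℤ_[p]ˣ :=
    (Units.map (PadicInt.toZModPow (p := p) (2 * M + 1) : ℤ_[p] →* ZMod (p ^ (2 * M + 1)))).ker
  have hWf : W.FiniteIndex := Subgroup.finiteIndex_ker _
  have : (W.prod V).FiniteIndex :=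
    ⟨by rw [Subgroup.index_prod]; exact mul_ne_zero hWf.index_ne_zero hVf.index_ne_zero⟩
  refine (W.prod V).finite_setOf_le.subset ?_
  rintro G ⟨⟨hi₁, hn₁⟩, hi₂, hn₂⟩
  have hVG : ∀ g ∈ V, ((1, g) : ℤ_[p]ˣ × ∀ i, SL(2, ℤ_[q i])) ∈ G := fun g hg =>
    mem_comap_inr_of_forall_dvd (Subgroup.pow_factorial_mem_of_index_le hi₂ hn₂)
      (fun i => PadicInt.exists_units_pow_dvd hc) g
      (fun i j k => by simpa using hV g hg i j k)
  rintro ⟨w, g⟩ ⟨hw, hg⟩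
  have hdvd : (p : ℤ_[p]) ^ (2 * M + 1) ∣ (w : ℤ_[p]) - 1 := by
    rw [← Ideal.mem_span_singleton, ← PadicInt.ker_toZModPow, RingHom.mem_ker, map_sub, map_one,
      sub_eq_zero]
    exact congrArg Units.val hw
  obtain ⟨v, rfl⟩ := PadicInt.exists_units_pow_eq hM w hdvd
  obtain ⟨⟨s, b⟩, hsb, hs⟩ := Subgroup.pow_factorial_mem_of_index_le hi₁ hn₁ v
  replace hs : s = v ^ N := hs
  have h := G.mul_mem (G.pow_mem hsb V.index)
    (G.inv_mem (hVG _ (V.pow_index_mem b)))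
  have h' := G.mul_mem h (hVG g hg)
  simpa [hs, M, pow_mul] using h'

end Product

/-- fix a prime `p`, and let `S = S_p × S_{≠p}` where `S_p = ℤ_p^×` and
`S_{≠p} = ∏_{ℓ ≠ p} SL₂(ℤ_ℓ)`.  For each real `B > 0`, there are only finitely many open
subgroups `G ≤ S` whose image `G_p` in `S_p` has (finite) index `< B` and whose image
`G_{≠p}` in `S_{≠p}` has (finite) index `< B`. -/
theorem finite_open_subgroups_of_indexes_lt
    (p : ℕ) (hp : p.Prime) [Fact p.Prime] (B : ℝ) (hB : 0 < B) :
    {G : Subgroup (ℤ_[p]ˣ × SNe p) |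
        IsOpen (G : Set (ℤ_[p]ˣ × SNe p)) ∧
        ((G.map (MonoidHom.fst ℤ_[p]ˣ (SNe p))).index ≠ 0 ∧
          (((G.map (MonoidHom.fst ℤ_[p]ˣ (SNe p))).index : ℝ) < B)) ∧
        ((G.map (MonoidHom.snd ℤ_[p]ˣ (SNe p))).index ≠ 0 ∧
          (((G.map (MonoidHom.snd ℤ_[p]ˣ (SNe p))).index : ℝ) < B))}.Finite := by
  have (i : {ℓ : ℕ // ℓ.Prime ∧ ℓ ≠ p}) : Fact i.1.Prime := ⟨i.2.1⟩
  have hfin := finite_subgroups_of_map_index_le p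
    (q := fun i : {ℓ : ℕ // ℓ.Prime ∧ ℓ ≠ p} => i.1) Subtype.val_injective ⌈B⌉₊
  refine Set.Finite.subset hfin ?_
  rintro G ⟨-, ⟨hi₁, hB₁⟩, hi₂, hB₂⟩
  exact ⟨⟨hi₁, Nat.cast_le.mp (hB₁.le.trans (Nat.le_ceil B))⟩,
    hi₂, Nat.cast_le.mp (hB₂.le.trans (Nat.le_ceil B))⟩
end
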